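/- arXiv:cs/0601134 — 2 statements merged into one kernel-verified Lean document; each statement's English description precedes it below -/
import Mathlib

section
/- Suppose T1 is a first-order theory in a language L1 and T2 is a first-order theory in a language L2, where L1 and L2 are disjoint except for the equality symbol (and are effectively presented). Suppose T1 and T2 are both stably infinite and the universal fragments of T1 and T2 are each decidable. Then the universal fragment of the union theory T1 ∪ T2 is decidable. -/
namespace Paper

open FirstOrder Language

section Encoding

variable {L : Language} [∀ n, Encodable (L.Functions n)] [∀ n, Encodable (L.Relations n)]

/-- A canonical encoding of sentences, derived from Mathlib's list encoding of
bounded formulas. -/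
instance sentenceEncodable : Encodable L.Sentence :=
  Encodable.ofLeftInjection
    (fun φ => BoundedFormula.listEncode φ)
    (fun l => (BoundedFormula.listDecode l)[0]?.bind
      (fun ψ => if h : ψ.1 = 0 then some (cast (by rw [h]) ψ.2) else none))
    (fun φ => by
      have h := BoundedFormula.listDecode_encode_list (L := L) (α := Empty) [⟨0, φ⟩]
      simp only [List.flatMap_singleton] at h
      simp [h])

end Encoding

/-- A sentence is universal if it is of the form `∀ x₁ … ∀ xₙ ψ` with `ψ` quantifier-free. -/
def IsUniversalSentence {L : Language} (φ : L.Sentence) : Prop :=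
  ∃ (n : ℕ) (ψ : L.BoundedFormula Empty n), ψ.IsQF ∧ φ = ψ.alls

/-- The universal fragment of a theory: the set of universal sentences it proves
(equivalently, by the Gödel completeness theorem, its universal semantic consequences). -/
def univFragment {L : Language} (T : L.Theory) : Set L.Sentence :=
  {φ | IsUniversalSentence φ ∧ T ⊨ᵇ φ}

/-- A set of objects with a canonical encoding is decidable if some computable function
decides membership via codes. -/
def DecidableVia {α : Type} [Encodable α] (S : Set α) : Prop :=
  ∃ f : ℕ → Bool, Computable f ∧ ∀ a : α, a ∈ S ↔ f (Encodable.encode a) = true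

end Paper
namespace Paper

open FirstOrder Language

/-- A theory `T` is stably infinite if every quantifier-free formula that is satisfied in
some model of `T` is satisfied in an infinite model of `T`. -/
def StablyInfinite {L : Language} (T : L.Theory) : Prop :=
  ∀ (n : ℕ) (φ : L.Formula (Fin n)), φ.IsQF →
    (∃ (M : Type) (S : L.Structure M), letI := S;
      (∀ ψ ∈ T, M ⊨ ψ) ∧ ∃ v : Fin n → M, φ.Realize v) →
    (∃ (M : Type) (S : L.Structure M), letI := S;
      (∀ ψ ∈ T, M ⊨ ψ) ∧ Infinite M ∧ ∃ v : Fin n → M, φ.Realize v)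

section

variable (L₁ L₂ : Language)
  [∀ n, Encodable (L₁.Functions n)] [∀ n, Encodable (L₁.Relations n)]
  [∀ n, Encodable (L₂.Functions n)] [∀ n, Encodable (L₂.Relations n)]

instance sumFunctionsEncodable : ∀ n, Encodable ((L₁.sum L₂).Functions n) := fun n =>
  inferInstanceAs (Encodable (L₁.Functions n ⊕ L₂.Functions n))

instance sumRelationsEncodable : ∀ n, Encodable ((L₁.sum L₂).Relations n) := fun n =>
  inferInstanceAs (Encodable (L₁.Relations n ⊕ L₂.Relations n))

end

end Paper
namespace Paper
namespace NO

open Encodable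

abbrev RT := ℕ ⊕ (ℕ × ℕ)
abbrev RTok := (ℕ × List RT) ⊕ ((ℕ × ℕ) ⊕ ℕ)
abbrev PTok := ℕ × ℕ × ℕ
abbrev St1 := (Bool × Bool) × ℕ × List PTok
abbrev Node := PTok × List ℕ
abbrev St2 := List ℕ × List Node

def conv (t : RT) : PTok := Sum.casesOn t (fun v => (0, 0, v)) (fun p => (1, p.1, p.2))

def step1 (s : St1) (t : RTok) : St1 :=
  bif s.1.2 then ((s.1.1, false), s.2) else
  Sum.casesOn t
    (fun p => if s.2.1 = 0 then (s.1, 1, s.2.2 ++ (3, 2, 0) :: p.2.map conv)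
      else (s.1, s.2.1 - 1, s.2.2 ++ p.2.map conv))
    (fun q => Sum.casesOn q
      (fun r => ((s.1.1, true), r.1, s.2.2 ++ [(2, r.1, r.2)]))
      (fun k => if k = 0 then (s.1, s.2.1, s.2.2 ++ [(4, 2, 0)])
        else if k = 1 then (if s.2.2.length = 0 then s else ((true, false), s.2))
        else (s.1, s.2.1, s.2.2 ++ [(5, 0, 0)])))

def pass1 (l : List RTok) : St1 := l.foldl step1 ((false, false), 0, [])

def push (e b : List ℕ) (nd : Node) : ℕ :=
  if nd.1.1 ≤ 1 then encode nd
  else if nd.1.1 = 2 then b.getD (encode nd) 0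
  else if nd.1.1 = 3 then (if e.getD (nd.2.getD 0 0) 0 = e.getD (nd.2.getD 1 0) 0 then 1 else 0)
  else if nd.1.1 = 4 then (if nd.2.getD 0 0 = 0 then 1 else nd.2.getD 1 0)
  else 0

def step2 (e b : List ℕ) (t : PTok) (s : St2) : St2 :=
  (push e b (t, s.1.take t.2.1) :: s.1.drop t.2.1,
    if t.1 ≤ 2 then (t, s.1.take t.2.1) :: s.2 else s.2)

def pass2 (e b : List ℕ) (l : List PTok) : St2 := l.foldr (step2 e b) ([], [])

def bound (nds : List Node) : ℕ := nds.foldr (fun nd m => max (encode nd) m) 0 + 1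

def vrt (M p : ℕ) : RT := Sum.inl (2 * (p % M) + 1)
def vtok (M p : ℕ) : RTok := Sum.inl (M, [vrt M p])
def tIMP : RTok := Sum.inr (Sum.inr 0)
def tALL : RTok := Sum.inr (Sum.inr 1)
def tFLS (M : ℕ) : RTok := Sum.inr (Sum.inr (M + 2))

def arrLit (M : ℕ) (e : List ℕ) (p q : ℕ) : List RTok :=
  if e.getD p 0 = e.getD q 0 then [tIMP, vtok M p, vtok M q]
  else [tIMP, tIMP, vtok M p, vtok M q, tFLS M]

def relToks (M : ℕ) (nd : Node) : List RTok :=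
  Sum.inr (Sum.inl (nd.1.2.1, nd.1.2.2 / 2)) :: Sum.inr (Sum.inr M) :: nd.2.map (vtok M)

def nodeLit (s M : ℕ) (b : List ℕ) (nd : Node) : List RTok :=
  if nd.1.2.2 % 2 = s then
    if nd.1.1 = 1 then
      [tIMP, vtok M (encode nd), Sum.inl (M, Sum.inr (nd.1.2.1, nd.1.2.2 / 2) :: nd.2.map (vrt M))]
    else if nd.1.1 = 2 then
      if b.getD (encode nd) 0 = 0 then tIMP :: tIMP :: (relToks M nd ++ [tFLS M])
      else tIMP :: relToks M nd
    else []
  else []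

def outToks (s M : ℕ) (e b : List ℕ) (nds : List Node) : List RTok :=
  (List.range M).map (fun _ => tALL) ++
    (((List.range M).flatMap fun p => (List.range M).flatMap fun q => arrLit M e p q) ++
    (nds.flatMap (nodeLit s M b) ++ [tFLS M]))

def allLists (K : ℕ) (M : ℕ) : List (List ℕ) :=
  Nat.rec [[]] (fun _ ls => ls.flatMap fun l => (List.range K).map fun a => a :: l) M

def cand (l : List PTok) : List (ℕ × ℕ) :=
  (allLists (bound (pass2 [] [] l).2) (bound (pass2 [] [] l).2)).flatMap fun e =>
    (allLists 2 (bound (pass2 [] [] l).2)).flatMap fun b =>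
      if (pass2 e b l).1.getD 0 0 = 0 then
        [(encode (outToks 0 (bound (pass2 [] [] l).2) e b (pass2 [] [] l).2),
          encode (outToks 1 (bound (pass2 [] [] l).2) e b (pass2 [] [] l).2))]
      else []

def decider (f₁ f₂ : ℕ → Bool) (c : ℕ) : Bool :=
  bif (pass1 ((decode c : Option (List RTok)).getD [])).1.1 then false else
    (cand (pass1 ((decode c : Option (List RTok)).getD [])).2.2).all fun p => f₁ p.1 || f₂ p.2

/-! computability -/

open Primrec

theorem prim_conv : Primrec conv := by
  refine Primrec.sumCasesOn Primrec.id (Primrec₂.mk ?_) (Primrec₂.mk ?_)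
  · exact (Primrec.const 0).pair ((Primrec.const 0).pair Primrec.snd)
  · exact (Primrec.const 1).pair ((Primrec.fst.comp Primrec.snd).pair (Primrec.snd.comp Primrec.snd))

section
variable {α : Type*} [Primcodable α]

theorem pEq {f g : α → ℕ} (hf : Primrec f) (hg : Primrec g) : PrimrecPred fun a => f a = g a :=
  Primrec.eq.comp hf hg

theorem pLe {f g : α → ℕ} (hf : Primrec f) (hg : Primrec g) : PrimrecPred fun a => f a ≤ g a :=
  Primrec.nat_le.comp hf hg

theorem pGetD {f : α → List ℕ} {g : α → ℕ} (hf : Primrec f) (hg : Primrec g) :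
    Primrec fun a => (f a).getD (g a) 0 := (Primrec.list_getD 0).comp hf hg

theorem pCons {β : Type*} [Primcodable β] {f : α → β} {g : α → List β} (hf : Primrec f)
    (hg : Primrec g) : Primrec fun a => f a :: g a := Primrec.list_cons.comp hf hg

theorem pApp {β : Type*} [Primcodable β] {f : α → List β} {g : α → List β} (hf : Primrec f)
    (hg : Primrec g) : Primrec fun a => f a ++ g a := Primrec.list_append.comp hf hg

theorem pEnc {β : Type*} [Primcodable β] {f : α → β} (hf : Primrec f) :
    Primrec fun a => encode (f a) := Primrec.encode.comp hf
end

theorem prim_step1 : Primrec₂ step1 := by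
  refine Primrec₂.mk ?_
  unfold step1
  have hs : Primrec fun a : St1 × RTok => a.1 := Primrec.fst
  refine Primrec.cond (snd.comp (fst.comp hs))
    (((fst.comp (fst.comp hs)).pair (const false)).pair (snd.comp hs)) ?_
  refine Primrec.sumCasesOn Primrec.snd (Primrec₂.mk ?_) (Primrec₂.mk ?_)
  · have hs : Primrec fun a : (St1 × RTok) × (ℕ × List RT) => a.1.1 := Primrec.fst.comp Primrec.fst
    have hm : Primrec fun a : (St1 × RTok) × (ℕ × List RT) => a.2.2.map conv :=
      Primrec.list_map (snd.comp snd) (prim_conv.comp₂ Primrec₂.right)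
    refine Primrec.ite (pEq (fst.comp (snd.comp hs)) (const 0)) ?_ ?_
    · exact (fst.comp hs).pair ((const 1).pair (pApp (snd.comp (snd.comp hs)) (pCons (const _) hm)))
    · exact (fst.comp hs).pair ((nat_sub.comp (fst.comp (snd.comp hs)) (const 1)).pair
        (pApp (snd.comp (snd.comp hs)) hm))
  · refine Primrec.sumCasesOn Primrec.snd (Primrec₂.mk ?_) (Primrec₂.mk ?_)
    · have hs : Primrec fun a : ((St1 × RTok) × ((ℕ × ℕ) ⊕ ℕ)) × (ℕ × ℕ) => a.1.1.1 :=
        fst.comp (fst.comp fst)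
      have hr : Primrec fun a : ((St1 × RTok) × ((ℕ × ℕ) ⊕ ℕ)) × (ℕ × ℕ) => a.2 := snd
      exact ((fst.comp (fst.comp hs)).pair (const true)).pair ((fst.comp hr).pair
        (pApp (snd.comp (snd.comp hs))
          (pCons ((const 2).pair ((fst.comp hr).pair (snd.comp hr))) (const []))))
    · have hs : Primrec fun a : ((St1 × RTok) × ((ℕ × ℕ) ⊕ ℕ)) × ℕ => a.1.1.1 :=
        fst.comp (fst.comp fst)
      refine Primrec.ite (pEq snd (const 0)) ?_ (Primrec.ite (pEq snd (const 1)) ?_ ?_)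
      · exact (fst.comp hs).pair ((fst.comp (snd.comp hs)).pair
          (pApp (snd.comp (snd.comp hs)) (const _)))
      · exact Primrec.ite (pEq (list_length.comp (snd.comp (snd.comp hs))) (const 0)) hs
          ((const _).pair (snd.comp hs))
      · exact (fst.comp hs).pair ((fst.comp (snd.comp hs)).pair
          (pApp (snd.comp (snd.comp hs)) (const _)))

theorem prim_pass1 : Primrec pass1 :=
  Primrec.list_foldl (h := fun _ p => step1 p.1 p.2) Primrec.id (const _) (Primrec₂.mk
    (prim_step1.comp (fst.comp snd) (snd.comp snd)))

section
variable {α : Type*} [Primcodable α]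

theorem prim_push {e b : α → List ℕ} {nd : α → Node} (he : Primrec e) (hb : Primrec b)
    (hn : Primrec nd) : Primrec fun a => push (e a) (b a) (nd a) := by
  unfold push
  have hk : Primrec fun a => (nd a).1.1 := fst.comp (fst.comp hn)
  have ha : ∀ i : ℕ, Primrec fun a => (nd a).2.getD i 0 := fun i => pGetD (snd.comp hn) (const i)
  refine Primrec.ite (pLe hk (const 1)) (pEnc hn) ?_
  refine Primrec.ite (pEq hk (const 2)) (pGetD hb (pEnc hn)) ?_
  refine Primrec.ite (pEq hk (const 3)) ?_ ?_
  · exact Primrec.ite (pEq (pGetD he (ha 0)) (pGetD he (ha 1))) (const 1) (const 0)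
  refine Primrec.ite (pEq hk (const 4)) ?_ (const 0)
  exact Primrec.ite (pEq (ha 0) (const 0)) (const 1) (ha 1)

theorem prim_step2 {e b : α → List ℕ} {t : α → PTok} {s : α → St2} (he : Primrec e)
    (hb : Primrec b) (ht : Primrec t) (hs : Primrec s) :
    Primrec fun a => step2 (e a) (b a) (t a) (s a) := by
  unfold step2
  have hk : Primrec fun a => (t a).2.1 := fst.comp (snd.comp ht)
  have hn : Primrec fun a => (((t a), (s a).1.take (t a).2.1) : Node) :=
    ht.pair (list_take.comp hk (fst.comp hs))
  exact (pCons (prim_push he hb hn) (list_drop.comp hk (fst.comp hs))).pair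
    (Primrec.ite (pLe (fst.comp ht) (const 2)) (pCons hn (snd.comp hs)) (snd.comp hs))

theorem prim_pass2 {e b : α → List ℕ} {l : α → List PTok} (he : Primrec e)
    (hb : Primrec b) (hl : Primrec l) :
    Primrec fun a => pass2 (e a) (b a) (l a) :=
  Primrec.list_foldr (h := fun a p => step2 (e a) (b a) p.1 p.2) hl (const _) (Primrec₂.mk
    (prim_step2 (he.comp fst) (hb.comp fst) (fst.comp snd) (snd.comp snd)))

theorem prim_bound : Primrec bound :=
  Primrec.succ.comp (Primrec.list_foldr (h := fun _ p => max (encode p.1) p.2)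
    Primrec.id (const 0) (Primrec₂.mk
    (nat_max.comp (pEnc (fst.comp snd)) (snd.comp snd))))

theorem prim_vrt {M p : α → ℕ} (hM : Primrec M) (hp : Primrec p) :
    Primrec fun a => vrt (M a) (p a) :=
  sumInl.comp (nat_double_succ.comp (nat_mod.comp hp hM))

theorem prim_vtok {M p : α → ℕ} (hM : Primrec M) (hp : Primrec p) :
    Primrec fun a => vtok (M a) (p a) :=
  sumInl.comp (hM.pair (pCons (prim_vrt hM hp) (const [])))

theorem prim_FLS {M : α → ℕ} (hM : Primrec M) : Primrec fun a => tFLS (M a) :=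
  sumInr.comp (sumInr.comp (nat_add.comp hM (const 2)))

theorem prim_arrLit {M p q : α → ℕ} {e : α → List ℕ} (hM : Primrec M) (he : Primrec e)
    (hp : Primrec p) (hq : Primrec q) : Primrec fun a => arrLit (M a) (e a) (p a) (q a) := by
  unfold arrLit
  refine Primrec.ite (pEq (pGetD he hp) (pGetD he hq)) ?_ ?_
  · exact pCons (const _) (pCons (prim_vtok hM hp) (pCons (prim_vtok hM hq) (const [])))
  · exact pCons (const _) (pCons (const _) (pCons (prim_vtok hM hp) (pCons (prim_vtok hM hq)
      (pCons (prim_FLS hM) (const [])))))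

theorem prim_relToks {M : α → ℕ} {nd : α → Node} (hM : Primrec M) (hn : Primrec nd) :
    Primrec fun a => relToks (M a) (nd a) := by
  unfold relToks
  refine pCons (sumInr.comp (sumInl.comp ((fst.comp (snd.comp (fst.comp hn))).pair
    (nat_div.comp (snd.comp (snd.comp (fst.comp hn))) (const 2))))) (pCons
    (sumInr.comp (sumInr.comp hM)) (Primrec.list_map (snd.comp hn) (Primrec₂.mk ?_)))
  exact prim_vtok (hM.comp fst) snd

theorem prim_nodeLit (s : ℕ) {M : α → ℕ} {b : α → List ℕ} {nd : α → Node} (hM : Primrec M)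
    (hb : Primrec b) (hn : Primrec nd) :
    Primrec fun a => nodeLit s (M a) (b a) (nd a) := by
  unfold nodeLit
  have hsym : Primrec fun a => (nd a).1.2.2 := snd.comp (snd.comp (fst.comp hn))
  have hk : Primrec fun a => (nd a).1.2.1 := fst.comp (snd.comp (fst.comp hn))
  refine Primrec.ite (pEq (nat_mod.comp hsym (const 2)) (const s)) ?_ (const [])
  refine Primrec.ite (pEq (fst.comp (fst.comp hn)) (const 1)) ?_ ?_
  · refine pCons (const _) (pCons (prim_vtok hM (pEnc hn)) (pCons (sumInl.comp (hM.pair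
      (pCons (sumInr.comp (hk.pair (nat_div.comp hsym (const 2))))
        (Primrec.list_map (snd.comp hn) (Primrec₂.mk ?_))))) (const [])))
    exact prim_vrt (hM.comp fst) snd
  refine Primrec.ite (pEq (fst.comp (fst.comp hn)) (const 2)) ?_ (const [])
  refine Primrec.ite (pEq (pGetD hb (pEnc hn)) (const 0)) ?_ ?_
  · exact pCons (const _) (pCons (const _) (pApp (prim_relToks hM hn)
      (pCons (prim_FLS hM) (const []))))
  · exact pCons (const _) (prim_relToks hM hn)

theorem prim_outToks (s : ℕ) {M : α → ℕ} {e b : α → List ℕ} {nds : α → List Node} (hM : Primrec M)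
    (he : Primrec e) (hb : Primrec b) (hn : Primrec nds) :
    Primrec fun a => outToks s (M a) (e a) (b a) (nds a) := by
  unfold outToks
  refine pApp (Primrec.list_map (list_range.comp hM) (Primrec₂.const _)) (pApp ?_ (pApp ?_
    (pCons (prim_FLS hM) (const []))))
  · refine Primrec.list_flatMap (list_range.comp hM) (Primrec₂.mk ?_)
    refine Primrec.list_flatMap (list_range.comp (hM.comp fst)) (Primrec₂.mk ?_)
    exact prim_arrLit (hM.comp (fst.comp fst)) (he.comp (fst.comp fst)) (snd.comp fst) snd
  · refine Primrec.list_flatMap hn (Primrec₂.mk ?_)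
    exact prim_nodeLit s (hM.comp fst) (hb.comp fst) snd

theorem prim_allLists {K M : α → ℕ} (hK : Primrec K) (hM : Primrec M) :
    Primrec fun a => allLists (K a) (M a) := by
  unfold allLists
  refine Primrec.nat_rec' (h := fun (a : α) (p : ℕ × List (List ℕ)) => p.2.flatMap fun l => (List.range (K a)).map
    fun x => x :: l) hM (const _) (Primrec₂.mk ?_)
  refine Primrec.list_flatMap (snd.comp snd) (Primrec₂.mk ?_)
  refine Primrec.list_map (list_range.comp (hK.comp (fst.comp fst))) (Primrec₂.mk ?_)
  exact pCons snd (snd.comp fst)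

theorem prim_cand : Primrec cand := by
  unfold cand
  have hnd : Primrec fun l : List PTok => (pass2 [] [] l).2 :=
    snd.comp (prim_pass2 (const []) (const []) Primrec.id)
  have hM : Primrec fun l : List PTok => bound (pass2 [] [] l).2 := prim_bound.comp hnd
  refine Primrec.list_flatMap (prim_allLists hM hM) (Primrec₂.mk ?_)
  refine Primrec.list_flatMap (prim_allLists (const 2) (hM.comp fst)) (Primrec₂.mk ?_)
  have hl : Primrec fun a : (List PTok × List ℕ) × List ℕ => a.1.1 := fst.comp fst
  have he : Primrec fun a : (List PTok × List ℕ) × List ℕ => a.1.2 := snd.comp fst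
  have hb : Primrec fun a : (List PTok × List ℕ) × List ℕ => a.2 := snd
  refine Primrec.ite (pEq (pGetD (fst.comp (prim_pass2 he hb hl)) (const 0)) (const 0)) ?_ (const [])
  exact pCons ((pEnc (prim_outToks 0 (hM.comp hl) he hb (hnd.comp hl))).pair
    (pEnc (prim_outToks 1 (hM.comp hl) he hb (hnd.comp hl)))) (const [])

theorem comp_all {β : Type*} [Primcodable β] {p : β → Bool} (hp : Computable p) {l : α → List β}
    (hl : Computable l) : Computable fun a => (l a).all p := by
  have h : Computable fun a => (Nat.rec (motive := fun _ => Bool) true (fun n r =>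
      r && (((l a)[n]?).map p).getD true) (l a).length : Bool) := by
    refine Computable.nat_rec (h := fun a q => q.2 && (((l a)[q.1]?).map p).getD true) (Computable.list_length.comp hl) (Computable.const true)
      (Computable₂.mk ?_)
    refine (Primrec.dom_bool₂ and).to_comp.comp (Computable.snd.comp Computable.snd) ?_
    refine Computable.option_getD ?_ (Computable.const true)
    refine Computable.option_map (Computable.list_getElem?.comp (hl.comp Computable.fst)
      (Computable.fst.comp Computable.snd)) ?_
    exact hp.comp₂ Computable.snd.to₂
  refine h.of_eq fun a => ?_
  generalize l a = l
  have key : ∀ k ≤ l.length, (Nat.rec (motive := fun _ => Bool) true (fun n r =>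
      r && ((l[n]?).map p).getD true) k : Bool) = (l.take k).all p := by
    intro k hk
    induction k with
    | zero => simp
    | succ k ih =>
      have hk' : k < l.length := hk
      simp only [ih hk'.le]
      rw [List.take_add_one, List.all_append]
      simp [hk']
  rw [key _ le_rfl, List.take_length]

theorem comp_decider {f₁ f₂ : ℕ → Bool} (h₁ : Computable f₁) (h₂ : Computable f₂) :
    Computable (decider f₁ f₂) := by
  unfold decider
  have hp : Primrec fun c : ℕ => pass1 ((decode c : Option (List RTok)).getD []) :=
    prim_pass1.comp (option_getD.comp Primrec.decode (const []))
  refine Computable.cond (fst.comp (fst.comp hp)).to_comp (Computable.const false) ?_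
  refine comp_all (p := fun p : ℕ × ℕ => f₁ p.1 || f₂ p.2) ?_ (prim_cand.comp (snd.comp (snd.comp hp))).to_comp
  exact (Primrec.dom_bool₂ or).to_comp.comp (h₁.comp Computable.fst) (h₂.comp Computable.snd)

end

end NO
end Paper
set_option linter.unusedSectionVars false
namespace Paper
namespace NO

open Encodable FirstOrder Language

section
variable {L : FirstOrder.Language.{0, 0}} [∀ n, Encodable (L.Functions n)] [∀ n, Encodable (L.Relations n)]

def encT {n : ℕ} (x : (Empty ⊕ Fin n) ⊕ (Σ i, L.Functions i)) : RT :=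
  Sum.map encode (fun f => (f.1, encode f.2)) x

def encTok (x : (Σ k, L.Term (Empty ⊕ Fin k)) ⊕ ((Σ n, L.Relations n) ⊕ ℕ)) : RTok :=
  Sum.map (fun t => (t.1, t.2.listEncode.map encT)) (Sum.map (fun r => (r.1, encode r.2)) id) x

theorem encode_list_map {α β : Type} [Encodable α] [Encodable β] (f : α → β)
    (hf : ∀ a, encode (f a) = encode a) (l : List α) : encode (l.map f) = encode l := by
  induction l with
  | nil => rfl
  | cons a l ih => simp [encode_list_cons, hf, ih]

theorem encode_encT {n : ℕ} (x : (Empty ⊕ Fin n) ⊕ (Σ i, L.Functions i)) :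
    encode (encT x) = encode x := by
  rcases x with x | ⟨k, f⟩
  · rfl
  · rfl

theorem encode_term {α : Type} [Encodable α] (t : L.Term α) : encode t = encode t.listEncode := rfl

theorem encode_encTok (x : (Σ k, L.Term (Empty ⊕ Fin k)) ⊕ ((Σ n, L.Relations n) ⊕ ℕ)) :
    encode (encTok x) = encode x := by
  rcases x with ⟨k, t⟩ | ⟨k, r⟩ | k
  · have h : encode ((t.listEncode.map encT : List RT)) = encode t :=
      encode_list_map _ encode_encT _
    change 2 * Nat.pair k (encode ((t.listEncode.map encT : List RT))) = 2 * Nat.pair k (encode t)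
    rw [h]
  · rfl
  · rfl

def rawF {n : ℕ} (φ : L.BoundedFormula Empty n) : List RTok := φ.listEncode.map encTok

theorem encode_sentence (φ : L.Sentence) : encode φ = encode (rawF φ) :=
  (encode_list_map _ encode_encTok φ.listEncode).symm

variable {n : ℕ}

def polT (t : L.Term (Empty ⊕ Fin n)) : List PTok := (t.listEncode.map encT).map conv

def nodeT : L.Term (Empty ⊕ Fin n) → Node
  | .var x => ((0, 0, encode x), [])
  | .func (l := k) f ts => ((1, k, encode f), (List.finRange k).map fun i => encode (nodeT (ts i)))

def ndsT : L.Term (Empty ⊕ Fin n) → List Node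
  | .var x => [((0, 0, encode x), [])]
  | .func (l := k) f ts => nodeT (.func f ts) :: (List.finRange k).flatMap fun i => ndsT (ts i)

def nodeR {k : ℕ} (R : L.Relations k) (ts : Fin k → L.Term (Empty ⊕ Fin n)) : Node :=
  ((2, k, encode R), (List.finRange k).map fun i => encode (nodeT (ts i)))

def polF : ∀ {n : ℕ}, L.BoundedFormula Empty n → List PTok
  | _, .falsum => [(5, 0, 0)]
  | _, .equal t₁ t₂ => (3, 2, 0) :: (polT t₁ ++ polT t₂)
  | _, .rel (l := k) R ts => (2, k, encode R) :: (List.finRange k).flatMap fun i => polT (ts i)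
  | _, .imp φ₁ φ₂ => (4, 2, 0) :: (polF φ₁ ++ polF φ₂)
  | _, .all φ => polF φ

def ndsF : ∀ {n : ℕ}, L.BoundedFormula Empty n → List Node
  | _, .falsum => []
  | _, .equal t₁ t₂ => ndsT t₁ ++ ndsT t₂
  | _, .rel (l := k) R ts => nodeR R ts :: (List.finRange k).flatMap fun i => ndsT (ts i)
  | _, .imp φ₁ φ₂ => ndsF φ₁ ++ ndsF φ₂
  | _, .all φ => ndsF φ

def evF (e b : List ℕ) : ∀ {n : ℕ}, L.BoundedFormula Empty n → ℕ
  | _, .falsum => 0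
  | _, .equal t₁ t₂ =>
      if e.getD (encode (nodeT t₁)) 0 = e.getD (encode (nodeT t₂)) 0 then 1 else 0
  | _, .rel R ts => b.getD (encode (nodeR R ts)) 0
  | _, .imp φ₁ φ₂ => if evF e b φ₁ = 0 then 1 else evF e b φ₂
  | _, .all φ => evF e b φ

def hasAll : ∀ {n : ℕ}, L.BoundedFormula Empty n → Bool
  | _, .falsum => false
  | _, .equal _ _ => false
  | _, .rel _ _ => false
  | _, .imp φ₁ φ₂ => hasAll φ₁ || hasAll φ₂
  | _, .all _ => true

def isBad : ∀ {n : ℕ}, L.BoundedFormula Empty n → Bool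
  | _, .falsum => false
  | _, .equal _ _ => false
  | _, .rel _ _ => false
  | _, .imp φ₁ φ₂ => hasAll φ₁ || hasAll φ₂
  | _, .all φ => isBad φ

theorem hasAll_iff (φ : L.BoundedFormula Empty n) : hasAll φ = false ↔ φ.IsQF := by
  constructor
  · intro h
    induction φ with
    | falsum => exact .falsum
    | equal => exact (BoundedFormula.IsAtomic.equal _ _).isQF
    | rel => exact (BoundedFormula.IsAtomic.rel _ _).isQF
    | imp _ _ h₁ h₂ => simp [hasAll] at h; exact (h₁ h.1).imp (h₂ h.2)
    | all => simp [hasAll] at h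
  · intro h
    induction h with
    | falsum => rfl
    | of_isAtomic h => cases h <;> rfl
    | imp _ _ h₁ h₂ => simp [hasAll, h₁, h₂]

theorem isBad_of_hasAll (φ : L.BoundedFormula Empty n) (h : hasAll φ = false) :
    isBad φ = false := by
  cases φ <;> simp_all [hasAll, isBad]

theorem univ_of_isBad (φ : L.BoundedFormula Empty n) (h : isBad φ = false) :
    IsUniversalSentence φ.alls := by
  induction φ with
  | all φ ih => exact ih h
  | falsum => exact ⟨_, _, (hasAll_iff .falsum).1 rfl, rfl⟩
  | equal => exact ⟨_, _, (hasAll_iff (.equal _ _)).1 rfl, rfl⟩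
  | rel => exact ⟨_, _, (hasAll_iff (.rel _ _)).1 rfl, rfl⟩
  | imp φ₁ φ₂ => exact ⟨_, φ₁.imp φ₂, (hasAll_iff (.imp φ₁ φ₂)).1 h, rfl⟩

theorem isBad_alls (φ : L.BoundedFormula Empty n) : isBad φ.alls = isBad φ := by
  induction n with
  | zero => rfl
  | succ n ih => exact ih φ.all

theorem polF_alls (φ : L.BoundedFormula Empty n) : polF φ.alls = polF φ := by
  induction n with
  | zero => rfl
  | succ n ih => exact ih φ.all

theorem univ_iff (φ : L.Sentence) : IsUniversalSentence φ ↔ isBad φ = false := by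
  constructor
  · rintro ⟨n, ψ, h, rfl⟩
    rw [isBad_alls]
    exact isBad_of_hasAll _ ((hasAll_iff _).2 h)
  · exact univ_of_isBad φ

theorem fold_terms (bad : Bool) (l : List (L.Term (Empty ⊕ Fin n))) (acc : List PTok) :
    (l.map fun t => encTok (L := L) (Sum.inl ⟨n, t⟩)).foldl step1 ((bad, false), l.length, acc) =
      ((bad, false), 0, acc ++ l.flatMap polT) := by
  induction l generalizing acc with
  | nil => simp
  | cons t l ih =>
    simp only [List.map_cons, List.foldl_cons, List.flatMap_cons, List.length_cons]
    rw [← List.append_assoc, ← ih]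
    rfl

theorem fold_rel (bad : Bool) {k : ℕ} (R : L.Relations k) (ts : Fin k → L.Term (Empty ⊕ Fin n))
    (acc : List PTok) :
    (rawF (.rel R ts)).foldl step1 ((bad, false), 0, acc) =
      ((bad, false), 0, acc ++ polF (.rel R ts)) := by
  have h := fold_terms bad ((List.finRange k).map ts) (acc ++ [(2, k, encode R)])
  simp only [List.map_map, List.length_map, List.length_finRange, List.flatMap_map,
    List.append_assoc, List.singleton_append] at h
  rw [polF, ← h, rawF, BoundedFormula.listEncode, List.map_append, List.foldl_append, List.map_map]
  rfl

theorem fold_step1 (φ : L.BoundedFormula Empty n) (bad : Bool) (acc : List PTok)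
    (hacc : acc.length ≠ 0) :
    (rawF φ).foldl step1 ((bad, false), 0, acc) = ((bad || hasAll φ, false), 0, acc ++ polF φ) := by
  induction φ generalizing bad acc with
  | falsum => simp [rawF, BoundedFormula.listEncode, encTok, step1, polF, hasAll]
  | equal t₁ t₂ =>
    simp [rawF, BoundedFormula.listEncode, encTok, step1, polF, hasAll, polT]
  | rel R ts => rw [fold_rel]; simp [hasAll]
  | imp φ₁ φ₂ h₁ h₂ =>
    have : rawF (φ₁.imp φ₂) = tIMP :: (rawF φ₁ ++ rawF φ₂) := by
      simp [rawF, BoundedFormula.listEncode, tIMP, encTok]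
    rw [this, List.foldl_cons, List.foldl_append]
    have : step1 ((bad, false), 0, acc) tIMP = ((bad, false), 0, acc ++ [(4, 2, 0)]) := rfl
    rw [this, h₁ _ _ (by simp), h₂ _ _ (by simp)]
    simp [hasAll, polF, Bool.or_assoc]
  | all φ h =>
    have : rawF φ.all = tALL :: rawF φ := by
      simp [rawF, BoundedFormula.listEncode, tALL, encTok]
    rw [this, List.foldl_cons]
    have : step1 ((bad, false), 0, acc) tALL = ((true, false), 0, acc) := by
      simp only [step1, tALL]; simp [hacc]
    rw [this, h _ _ hacc]
    simp [hasAll, polF]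

theorem pass1_raw (φ : L.BoundedFormula Empty n) :
    pass1 (rawF φ) = ((isBad φ, false), 0, polF φ) := by
  unfold pass1
  induction φ with
  | falsum => simp [rawF, BoundedFormula.listEncode, encTok, step1, polF, isBad]
  | equal t₁ t₂ =>
    simp [rawF, BoundedFormula.listEncode, encTok, step1, polF, isBad, polT]
  | rel R ts => rw [fold_rel]; simp [isBad]
  | imp φ₁ φ₂ h₁ h₂ =>
    have : rawF (φ₁.imp φ₂) = tIMP :: (rawF φ₁ ++ rawF φ₂) := by
      simp [rawF, BoundedFormula.listEncode, tIMP, encTok]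
    rw [this, List.foldl_cons, List.foldl_append]
    have : step1 ((false, false), 0, []) tIMP = ((false, false), 0, [(4, 2, 0)]) := rfl
    rw [this, fold_step1 _ _ _ (by simp), fold_step1 _ _ _ (by simp)]
    simp [isBad, polF]
  | all φ h =>
    have : rawF φ.all = tALL :: rawF φ := by
      simp [rawF, BoundedFormula.listEncode, tALL, encTok]
    rw [this, List.foldl_cons]
    exact h

/-! pass 2 -/

theorem fold_flat (e b : List ℕ) {ι : Type} (l : List ι) (ts : ι → L.Term (Empty ⊕ Fin n))
    (ih : ∀ i (s : St2), (polT (ts i)).foldr (step2 e b) s =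
      (encode (nodeT (ts i)) :: s.1, ndsT (ts i) ++ s.2)) (s : St2) :
    (l.flatMap fun i => polT (ts i)).foldr (step2 e b) s =
      ((l.map fun i => encode (nodeT (ts i))) ++ s.1, (l.flatMap fun i => ndsT (ts i)) ++ s.2) := by
  induction l with
  | nil => rfl
  | cons i l h => simp [List.foldr_append, h, ih]

theorem fold2_term (e b : List ℕ) (t : L.Term (Empty ⊕ Fin n)) (s : St2) :
    (polT t).foldr (step2 e b) s = (encode (nodeT t) :: s.1, ndsT t ++ s.2) := by
  induction t generalizing s with
  | var x => simp [polT, Term.listEncode, encT, conv, step2, push, nodeT, ndsT]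
  | @func k f ts ih =>
    have h : polT (Term.func f ts) = (1, k, encode f) ::
        (List.finRange k).flatMap fun i => polT (ts i) := by
      simp [polT, Term.listEncode, encT, conv, List.map_flatMap]
    rw [h, List.foldr_cons, fold_flat e b _ _ ih]
    simp [step2, push, nodeT, ndsT]

theorem fold2_form (e b : List ℕ) (φ : L.BoundedFormula Empty n) (s : St2) :
    (polF φ).foldr (step2 e b) s = (evF e b φ :: s.1, ndsF φ ++ s.2) := by
  induction φ generalizing s with
  | falsum => simp [polF, step2, push, evF, ndsF]
  | equal t₁ t₂ =>
    simp [polF, step2, push, evF, ndsF, List.foldr_append, fold2_term]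
  | @rel n k R ts =>
    rw [polF, List.foldr_cons, fold_flat e b _ _ (fun i => fold2_term e b (ts i))]
    simp [step2, push, nodeR, evF, ndsF]
  | imp φ₁ φ₂ h₁ h₂ =>
    simp [polF, step2, push, evF, ndsF, List.foldr_append, h₁, h₂]
  | all φ h => simp [polF, evF, ndsF, h]

theorem pass2_pol (e b : List ℕ) (φ : L.BoundedFormula Empty n) :
    pass2 e b (polF φ) = ([evF e b φ], ndsF φ) := by
  rw [pass2, fold2_form]; simp

theorem lt_bound {nds : List Node} {nd : Node} (h : nd ∈ nds) : encode nd < bound nds := by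
  unfold bound
  induction nds with
  | nil => simp at h
  | cons a l ih =>
    rw [List.foldr_cons]
    rcases List.mem_cons.1 h with rfl | h
    · omega
    · have := ih h; omega

theorem mem_allLists (K M : ℕ) (l : List ℕ) :
    l ∈ allLists K M ↔ l.length = M ∧ ∀ a ∈ l, a < K := by
  induction M generalizing l with
  | zero => simp [allLists]; rintro rfl; simp
  | succ M ih =>
    have : allLists K (M + 1) = (allLists K M).flatMap fun l => (List.range K).map fun a => a :: l :=
      rfl
    rw [this]
    simp only [List.mem_flatMap, List.mem_map, List.mem_range, ih]
    constructor
    · rintro ⟨l, ⟨rfl, h⟩, a, ha, rfl⟩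
      simpa [ha] using h
    · rcases l with _ | ⟨a, l⟩
      · simp
      · simp only [List.length_cons, List.mem_cons, forall_eq_or_imp, Nat.add_right_cancel_iff]
        rintro ⟨h, ha, h'⟩
        exact ⟨l, ⟨h, h'⟩, a, ha, rfl⟩

/-- Correctness of the raw decider in terms of typed data. -/
theorem decider_iff (f₁ f₂ : ℕ → Bool) (φ : L.Sentence) :
    decider f₁ f₂ (encode φ) = true ↔ isBad φ = false ∧
      ∀ e b : List ℕ, (e.length = bound (ndsF φ) ∧ ∀ a ∈ e, a < bound (ndsF φ)) →
        (b.length = bound (ndsF φ) ∧ ∀ a ∈ b, a < 2) → evF e b φ = 0 →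
        f₁ (encode (outToks 0 (bound (ndsF φ)) e b (ndsF φ))) = true ∨
        f₂ (encode (outToks 1 (bound (ndsF φ)) e b (ndsF φ))) = true := by
  unfold decider
  rw [encode_sentence, Encodable.encodek, Option.getD_some, pass1_raw]
  cases hb : isBad φ
  · simp only [cond_false, List.all_eq_true, true_and, cand, pass2_pol, List.mem_flatMap,
      mem_allLists, List.getD_cons_zero]
    constructor
    · intro h e b he hb hv
      have := h (_, _) ⟨e, he, b, hb, by rw [if_pos hv]; exact List.mem_singleton.2 rfl⟩
      simpa using this
    · rintro h x ⟨e, he, b, hb, hx⟩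
      split_ifs at hx with hv
      · rw [List.mem_singleton.1 hx]
        simpa using h e b he hb hv
      · simp at hx
  · simp

end
end NO
end Paper
set_option linter.unusedSectionVars false
namespace Paper
namespace NO

open Encodable FirstOrder Language

section
variable {L : FirstOrder.Language.{0, 0}} [∀ n, Encodable (L.Functions n)]
  [∀ n, Encodable (L.Relations n)]
variable {L' : FirstOrder.Language.{0, 0}} [∀ n, Encodable (L'.Functions n)]
  [∀ n, Encodable (L'.Relations n)]

structure Side (L L' : FirstOrder.Language.{0, 0}) [∀ n, Encodable (L.Functions n)]
    [∀ n, Encodable (L.Relations n)] [∀ n, Encodable (L'.Functions n)]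
    [∀ n, Encodable (L'.Relations n)] (s : ℕ) where
  pF : ∀ {k : ℕ}, L.Functions k → Option (L'.Functions k)
  pR : ∀ {k : ℕ}, L.Relations k → Option (L'.Relations k)
  hF : ∀ {k : ℕ} (f : L.Functions k) (f' : L'.Functions k), pF f = some f' →
    encode f % 2 = s ∧ encode f / 2 = encode f'
  hR : ∀ {k : ℕ} (f : L.Relations k) (f' : L'.Relations k), pR f = some f' →
    encode f % 2 = s ∧ encode f / 2 = encode f'
  nF : ∀ {k : ℕ} (f : L.Functions k), pF f = none → encode f % 2 ≠ s
  nR : ∀ {k : ℕ} (f : L.Relations k), pR f = none → encode f % 2 ≠ s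

variable {s : ℕ} (σ : Side L L' s) {n : ℕ} (M : ℕ) [NeZero M]

def yv (L' : FirstOrder.Language.{0, 0}) (M : ℕ) [NeZero M] (p : ℕ) : L'.Term (Empty ⊕ Fin M) :=
  .var (Sum.inr (Fin.ofNat M p))

def litsT : L.Term (Empty ⊕ Fin n) → List (L'.BoundedFormula Empty M)
  | .var _ => []
  | .func (l := k) f ts =>
    (match σ.pF f with
      | some f' => [.equal (yv L' M (encode (nodeT (.func f ts))))
          (.func f' fun i => yv L' M (encode (nodeT (ts i))))]
      | none => []) ++ (List.finRange k).flatMap fun i => litsT (ts i)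

def litsF (b : List ℕ) : ∀ {n : ℕ}, L.BoundedFormula Empty n → List (L'.BoundedFormula Empty M)
  | _, .falsum => []
  | _, .equal t₁ t₂ => litsT σ M t₁ ++ litsT σ M t₂
  | _, .rel (l := k) R ts =>
    (match σ.pR R with
      | some R' => [if b.getD (encode (nodeR R ts)) 0 = 0 then
            (BoundedFormula.rel R' fun i => yv L' M (encode (nodeT (ts i)))).imp .falsum
          else .rel R' fun i => yv L' M (encode (nodeT (ts i)))]
      | none => []) ++ (List.finRange k).flatMap fun i => litsT σ M (ts i)
  | _, .imp φ₁ φ₂ => litsF b φ₁ ++ litsF b φ₂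
  | _, .all φ => litsF b φ

def arrF (L' : FirstOrder.Language.{0, 0}) (e : List ℕ) (p q : ℕ) : L'.BoundedFormula Empty M :=
  if e.getD p 0 = e.getD q 0 then .equal (yv L' M p) (yv L' M q)
  else (BoundedFormula.equal (yv L' M p) (yv L' M q)).imp .falsum

def imps {M : ℕ} (l : List (L'.BoundedFormula Empty M)) : L'.BoundedFormula Empty M :=
  l.foldr (fun ℓ φ => ℓ.imp φ) .falsum

def lits (e b : List ℕ) (φ : L.BoundedFormula Empty n) : List (L'.BoundedFormula Empty M) :=
  ((List.range M).flatMap fun p => (List.range M).map fun q => arrF M L' e p q) ++ litsF σ M b φ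

theorem encTok_yv (p : ℕ) : encTok (L := L') (Sum.inl ⟨M, yv L' M p⟩) = vtok M p := rfl

theorem raw_arr (e : List ℕ) (p q : ℕ) : tIMP :: rawF (arrF M L' e p q) = arrLit M e p q := by
  unfold arrF arrLit
  split_ifs <;> rfl

theorem raw_args {k : ℕ} (g : Fin k → ℕ) (l : List (Fin k)) :
    (l.map fun i => vrt M (g i)) = List.map (encT (L := L'))
      (l.flatMap fun i => [Sum.inl (Sum.inr (Fin.ofNat M (g i)))]) := by
  induction l with
  | nil => rfl
  | cons a l ih => rw [List.map_cons, ih, List.flatMap_cons, List.map_append]; rfl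

theorem raw_litsT (b : List ℕ) (t : L.Term (Empty ⊕ Fin n)) :
    (ndsT t).flatMap (nodeLit s M b) = (litsT σ M t).flatMap fun ℓ => tIMP :: rawF ℓ := by
  induction t with
  | var x => simp [ndsT, nodeLit, litsT]
  | @func k f ts ih =>
    rw [ndsT, litsT, List.flatMap_cons, List.flatMap_append]
    congr 1
    · rcases h : σ.pF f with _ | f'
      · have := σ.nF f h
        simp [nodeLit, nodeT, this]
      · obtain ⟨h1, h2⟩ := σ.hF f f' h
        simp only [nodeLit, List.flatMap_cons, List.flatMap_nil, List.append_nil]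
        rw [if_pos (by simpa [nodeT] using h1), if_pos (by simp [nodeT])]
        simp only [rawF, BoundedFormula.listEncode, List.map_cons, List.map_nil, encTok_yv]
        congr 3
        simp [encTok, nodeT, Term.listEncode, encT, h2, yv, vrt]
        simp only [Function.comp_def]
        exact raw_args M _ _
    · rw [List.flatMap_assoc, List.flatMap_assoc]
      simp only [ih]

theorem raw_flat (b : List ℕ) {k : ℕ} (ts : Fin k → L.Term (Empty ⊕ Fin n)) :
    ((List.finRange k).flatMap fun i => ndsT (ts i)).flatMap (nodeLit s M b) =
    ((List.finRange k).flatMap fun i => litsT σ M (ts i)).flatMap fun ℓ => tIMP :: rawF ℓ := by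
  rw [List.flatMap_assoc, List.flatMap_assoc]
  simp only [raw_litsT σ M b]

theorem raw_rel {k : ℕ} (R : L.Relations k) (R' : L'.Relations k) (h : σ.pR R = some R')
    (ts : Fin k → L.Term (Empty ⊕ Fin n)) :
    rawF (BoundedFormula.rel R' fun i => yv L' M (encode (nodeT (ts i)))) =
      relToks M (nodeR R ts) := by
  obtain ⟨h1, h2⟩ := σ.hR R R' h
  simp only [rawF, BoundedFormula.listEncode, relToks, nodeR, h2, List.map_append, List.map_map]
  rfl

theorem raw_imp {M : ℕ} (φ₁ φ₂ : L'.BoundedFormula Empty M) :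
    rawF (φ₁.imp φ₂) = tIMP :: (rawF φ₁ ++ rawF φ₂) := by
  simp [rawF, BoundedFormula.listEncode, tIMP, encTok]

theorem raw_fls {M : ℕ} : rawF (.falsum : L'.BoundedFormula Empty M) = [tFLS M] := rfl

theorem raw_litsF (b : List ℕ) (φ : L.BoundedFormula Empty n) :
    (ndsF φ).flatMap (nodeLit s M b) = (litsF σ M b φ).flatMap fun ℓ => tIMP :: rawF ℓ := by
  induction φ with
  | falsum => rfl
  | equal t₁ t₂ => simp only [ndsF, litsF, List.flatMap_append, raw_litsT σ M b]
  | @rel n k R ts =>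
    rw [ndsF, litsF, List.flatMap_cons, List.flatMap_append, raw_flat σ]
    congr 1
    rcases h : σ.pR R with _ | R'
    · have := σ.nR R h
      simp [nodeLit, nodeR, this]
    · obtain ⟨h1, h2⟩ := σ.hR R R' h
      simp only [nodeLit, List.flatMap_cons, List.flatMap_nil, List.append_nil]
      rw [if_pos (by simpa [nodeR] using h1), if_neg (by simp [nodeR]), if_pos (by simp [nodeR])]
      split_ifs
      · rw [raw_imp, raw_rel σ M R R' h, raw_fls]
      · rw [raw_rel σ M R R' h]
  | imp φ₁ φ₂ h₁ h₂ => simp only [ndsF, litsF, List.flatMap_append, h₁, h₂]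
  | all φ h => exact h

theorem raw_imps {M : ℕ} (l : List (L'.BoundedFormula Empty M)) :
    rawF (imps l) = (l.flatMap fun ℓ => tIMP :: rawF ℓ) ++ [tFLS M] := by
  induction l with
  | nil => rfl
  | cons ℓ l ih =>
    have : imps (ℓ :: l) = ℓ.imp (imps l) := rfl
    rw [this, raw_imp, ih]; simp

theorem raw_alls {M : ℕ} (φ : L'.BoundedFormula Empty M) :
    rawF φ.alls = (List.range M).map (fun _ => tALL) ++ rawF φ := by
  induction M with
  | zero => rfl
  | succ M ih =>
    have : φ.alls = φ.all.alls := rfl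
    rw [this, ih, List.range_succ, List.map_append, List.append_assoc]
    rfl

theorem encode_out (e b : List ℕ) (φ : L.BoundedFormula Empty n) :
    encode (outToks s M e b (ndsF φ)) =
      encode ((imps (lits σ M e b φ)).alls : L'.Sentence) := by
  rw [encode_sentence, raw_alls, raw_imps, outToks, raw_litsF σ, lits, List.flatMap_append,
    List.append_assoc]
  congr 3
  rw [List.flatMap_assoc]
  simp only [List.flatMap_map, raw_arr]

theorem litsT_QF (t : L.Term (Empty ⊕ Fin n)) : ∀ ℓ ∈ litsT σ M t, ℓ.IsQF := by
  induction t with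
  | var => simp [litsT]
  | @func k f ts ih =>
    intro ℓ hℓ
    rw [litsT, List.mem_append] at hℓ
    rcases hℓ with hℓ | hℓ
    · split at hℓ
      · rw [List.mem_singleton.1 hℓ]; exact (BoundedFormula.IsAtomic.equal _ _).isQF
      · simp at hℓ
    · obtain ⟨i, -, hi⟩ := List.mem_flatMap.1 hℓ
      exact ih i ℓ hi

theorem litsF_QF (b : List ℕ) (φ : L.BoundedFormula Empty n) :
    ∀ ℓ ∈ litsF σ M b φ, ℓ.IsQF := by
  induction φ with
  | falsum => simp [litsF]
  | equal t₁ t₂ =>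
    intro ℓ hℓ
    rcases List.mem_append.1 hℓ with h | h
    exacts [litsT_QF σ M _ _ h, litsT_QF σ M _ _ h]
  | rel R ts =>
    intro ℓ hℓ
    rw [litsF, List.mem_append] at hℓ
    rcases hℓ with hℓ | hℓ
    · split at hℓ
      · rw [List.mem_singleton.1 hℓ]
        split_ifs
        · exact (BoundedFormula.IsAtomic.rel _ _).isQF.imp .falsum
        · exact (BoundedFormula.IsAtomic.rel _ _).isQF
      · simp at hℓ
    · obtain ⟨i, -, hi⟩ := List.mem_flatMap.1 hℓ
      exact litsT_QF σ M _ ℓ hi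
  | imp φ₁ φ₂ h₁ h₂ =>
    intro ℓ hℓ
    rcases List.mem_append.1 hℓ with h | h
    exacts [h₁ _ h, h₂ _ h]
  | all φ h => exact h

theorem imps_QF {M : ℕ} (l : List (L'.BoundedFormula Empty M)) (h : ∀ ℓ ∈ l, ℓ.IsQF) :
    (imps l).IsQF := by
  induction l with
  | nil => exact .falsum
  | cons a l ih =>
    exact (h a (by simp)).imp (ih fun ℓ hℓ => h ℓ (by simp [hℓ]))

theorem lits_QF (e b : List ℕ) (φ : L.BoundedFormula Empty n) :
    ∀ ℓ ∈ lits σ M e b φ, ℓ.IsQF := by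
  intro ℓ hℓ
  rcases List.mem_append.1 hℓ with h | h
  · obtain ⟨p, -, h⟩ := List.mem_flatMap.1 h
    obtain ⟨q, -, rfl⟩ := List.mem_map.1 h
    unfold arrF
    split_ifs
    · exact (BoundedFormula.IsAtomic.equal _ _).isQF
    · exact (BoundedFormula.IsAtomic.equal _ _).isQF.imp .falsum
  · exact litsF_QF σ M b φ ℓ h

theorem realize_imps {M : ℕ} (l : List (L'.BoundedFormula Empty M)) {N : Type} [L'.Structure N]
    (v : Empty → N) (xs : Fin M → N) :
    (imps l).Realize v xs ↔ ¬ ∀ ℓ ∈ l, ℓ.Realize v xs := by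
  induction l with
  | nil => simp [imps, BoundedFormula.Realize]
  | cons a l ih =>
    have : imps (a :: l) = a.imp (imps l) := rfl
    rw [this, BoundedFormula.realize_imp, ih]
    simp

end
end NO
end Paper
set_option linter.unusedSectionVars false
namespace Paper
namespace NO

open Encodable FirstOrder Language

section
variable {L : FirstOrder.Language.{0, 0}} [∀ n, Encodable (L.Functions n)]
  [∀ n, Encodable (L.Relations n)]
variable {L' : FirstOrder.Language.{0, 0}} [∀ n, Encodable (L'.Functions n)]
  [∀ n, Encodable (L'.Relations n)]
variable {s : ℕ} (σ : Side L L' s) {n : ℕ} (M : ℕ) [NeZero M]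

theorem ndsF_alls (φ : L.BoundedFormula Empty n) : ndsF φ.alls = ndsF φ := by
  induction n with
  | zero => rfl
  | succ n ih => exact ih φ.all

theorem evF_alls (e b : List ℕ) (φ : L.BoundedFormula Empty n) :
    evF e b φ.alls = evF e b φ := by
  induction n with
  | zero => rfl
  | succ n ih => exact ih φ.all

theorem litsF_alls (b : List ℕ) (φ : L.BoundedFormula Empty n) :
    litsF σ M b φ.alls = litsF σ M b φ := by
  induction n with
  | zero => rfl
  | succ n ih => exact ih φ.all

theorem lits_alls (e b : List ℕ) (φ : L.BoundedFormula Empty n) :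
    lits σ M e b φ.alls = lits σ M e b φ := by
  rw [lits, lits, litsF_alls]

theorem nodeT_mem (t : L.Term (Empty ⊕ Fin n)) : nodeT t ∈ ndsT t := by
  cases t <;> simp [ndsT, nodeT]

theorem nodeT_inj (t t' : L.Term (Empty ⊕ Fin n)) (h : nodeT t = nodeT t') : t = t' := by
  induction t generalizing t' with
  | var x =>
    cases t' with
    | var y => simp [nodeT] at h; rw [h]
    | func => simp [nodeT] at h
  | @func k f ts ih =>
    cases t' with
    | var y => simp [nodeT] at h
    | @func k' f' ts' =>
      simp only [nodeT, Prod.mk.injEq, true_and] at h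
      obtain ⟨⟨rfl, hf⟩, h2⟩ := h
      obtain rfl := encode_injective hf
      congr 1
      funext i
      refine ih i _ (encode_injective ?_)
      exact List.map_inj_left.1 h2 i (List.mem_finRange i)

theorem nodeR_inj {k k' : ℕ} (R : L.Relations k) (R' : L.Relations k')
    (ts : Fin k → L.Term (Empty ⊕ Fin n)) (ts' : Fin k' → L.Term (Empty ⊕ Fin n))
    (h : nodeR R ts = nodeR R' ts') :
    ∃ hk : k = k', hk ▸ R = R' ∧ ∀ i : Fin k, ts i = ts' (Fin.cast hk i) := by
  simp only [nodeR, Prod.mk.injEq, true_and] at h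
  obtain ⟨⟨rfl, hf⟩, h2⟩ := h
  refine ⟨rfl, encode_injective hf, fun i => nodeT_inj _ _ (encode_injective ?_)⟩
  exact List.map_inj_left.1 h2 i (List.mem_finRange i)

section sem
variable {N : Type} [L'.Structure N]

def goodT (Y : ℕ → N) : L.Term (Empty ⊕ Fin n) → Prop
  | .var _ => True
  | .func f ts =>
    (∀ f', σ.pF f = some f' → Y (encode (nodeT (.func f ts))) =
      Structure.funMap f' fun i => Y (encode (nodeT (ts i)))) ∧ ∀ i, goodT Y (ts i)

def goodF (b : List ℕ) (Y : ℕ → N) : ∀ {n : ℕ}, L.BoundedFormula Empty n → Prop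
  | _, .falsum => True
  | _, .equal t₁ t₂ => goodT σ Y t₁ ∧ goodT σ Y t₂
  | _, .rel R ts =>
    (∀ R', σ.pR R = some R' → (b.getD (encode (nodeR R ts)) 0 ≠ 0 ↔
      Structure.RelMap R' fun i => Y (encode (nodeT (ts i))))) ∧ ∀ i, goodT σ Y (ts i)
  | _, .imp φ₁ φ₂ => goodF b Y φ₁ ∧ goodF b Y φ₂
  | _, .all φ => goodF b Y φ

theorem realize_litsT (v : Empty → N) (xs : Fin M → N) (t : L.Term (Empty ⊕ Fin n)) :
    (∀ ℓ ∈ litsT σ M t, ℓ.Realize v xs) ↔ goodT σ (fun p => xs (Fin.ofNat M p)) t := by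
  induction t with
  | var => simp [litsT, goodT]
  | @func k f ts ih =>
    simp only [litsT, goodT, List.mem_append, or_imp, forall_and, List.mem_flatMap,
      List.mem_finRange, true_and, ← ih]
    refine and_congr ?_ ?_
    · rcases σ.pF f with _ | f'
      · simp
      · simp [BoundedFormula.Realize, yv]
    · constructor
      · exact fun h i ℓ hℓ => h ℓ ⟨i, hℓ⟩
      · rintro h ℓ ⟨i, hi⟩; exact h i ℓ hi

theorem realize_litsF (b : List ℕ) (v : Empty → N) (xs : Fin M → N)
    (φ : L.BoundedFormula Empty n) :
    (∀ ℓ ∈ litsF σ M b φ, ℓ.Realize v xs) ↔ goodF σ b (fun p => xs (Fin.ofNat M p)) φ := by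
  induction φ with
  | falsum => simp [litsF, goodF]
  | equal => simp only [litsF, goodF, List.mem_append, or_imp, forall_and, realize_litsT]
  | rel R ts =>
    simp only [litsF, goodF, List.mem_append, or_imp, forall_and, List.mem_flatMap,
      List.mem_finRange, true_and, ← realize_litsT σ M v xs]
    refine and_congr ?_ ?_
    · rcases σ.pR R with _ | f'
      · simp
      · by_cases hb : b.getD (encode (nodeR R ts)) 0 = 0
        · simp [-List.getD_eq_getElem?_getD, BoundedFormula.Realize, yv, hb]
        · simp [-List.getD_eq_getElem?_getD, BoundedFormula.Realize, yv, hb]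
    · constructor
      · exact fun h i ℓ hℓ => h ℓ ⟨i, hℓ⟩
      · rintro h ℓ ⟨i, hi⟩; exact h i ℓ hi
  | imp _ _ h₁ h₂ => simp only [litsF, goodF, List.mem_append, or_imp, forall_and, h₁, h₂]
  | all _ h => exact h

theorem realize_lits (e b : List ℕ) (v : Empty → N) (xs : Fin M → N)
    (φ : L.BoundedFormula Empty n) :
    (∀ ℓ ∈ lits σ M e b φ, ℓ.Realize v xs) ↔
      (∀ p < M, ∀ q < M, e.getD p 0 = e.getD q 0 ↔ xs (Fin.ofNat M p) = xs (Fin.ofNat M q)) ∧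
      goodF σ b (fun p => xs (Fin.ofNat M p)) φ := by
  rw [← realize_litsF σ M b v xs, lits]
  simp only [List.mem_append, or_imp, forall_and]
  refine and_congr ?_ Iff.rfl
  have key : ∀ p q, (arrF M L' e p q).Realize v xs ↔
      (e.getD p 0 = e.getD q 0 ↔ xs (Fin.ofNat M p) = xs (Fin.ofNat M q)) := by
    intro p q
    unfold arrF
    split_ifs with h
    · simp [-List.getD_eq_getElem?_getD, BoundedFormula.Realize, yv, h]
    · simp [-List.getD_eq_getElem?_getD, BoundedFormula.Realize, yv, h]
  simp only [List.mem_flatMap, List.mem_map, List.mem_range]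
  constructor
  · intro h p hp q hq
    exact (key p q).1 (h _ ⟨p, hp, q, hq, rfl⟩)
  · rintro h ℓ ⟨p, hp, q, hq, rfl⟩
    exact (key p q).2 (h p hp q hq)

variable [L.Structure N]

/-- Compatibility of an `L`-structure with an `L'`-structure along a side. -/
structure Compat (N : Type) [L.Structure N] [L'.Structure N] : Prop where
  cF : ∀ {k : ℕ} (f : L.Functions k) (f' : L'.Functions k), σ.pF f = some f' →
    ∀ x : Fin k → N, Structure.funMap f x = Structure.funMap f' x
  cR : ∀ {k : ℕ} (f : L.Relations k) (f' : L'.Relations k), σ.pR f = some f' →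
    ∀ x : Fin k → N, Structure.RelMap f x ↔ Structure.RelMap f' x

theorem goodT_of (hc : Compat σ N) (Y : ℕ → N) (v : Empty ⊕ Fin n → N)
    (t : L.Term (Empty ⊕ Fin n))
    (hY : ∀ t : L.Term (Empty ⊕ Fin n), encode (nodeT t) < M → Y (encode (nodeT t)) = t.realize v)
    (hM : ∀ nd ∈ ndsT t, encode nd < M) : goodT σ Y t := by
  induction t with
  | var => trivial
  | @func k f ts ih =>
    have hi : ∀ i, ∀ nd ∈ ndsT (ts i), encode nd < M := by
      intro i nd h
      refine hM nd ?_
      rw [ndsT, List.mem_cons, List.mem_flatMap]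
      exact Or.inr ⟨i, List.mem_finRange i, h⟩
    refine ⟨fun f' hf => ?_, fun i => ih i (hi i)⟩
    rw [hY _ (hM _ (nodeT_mem _)), Term.realize, hc.cF f f' hf]
    congr 1
    funext i
    rw [hY _ (hi i _ (nodeT_mem _))]

theorem goodF_of (hc : Compat σ N) (b : List ℕ) (Y : ℕ → N) (v : Empty → N) (xs : Fin n → N)
    (φ : L.BoundedFormula Empty n) (hφ : φ.IsQF)
    (hY : ∀ t : L.Term (Empty ⊕ Fin n), encode (nodeT t) < M →
      Y (encode (nodeT t)) = t.realize (Sum.elim v xs))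
    (hb : ∀ {k : ℕ} (R : L.Relations k) (ts : Fin k → L.Term (Empty ⊕ Fin n)),
      encode (nodeR R ts) < M → (b.getD (encode (nodeR R ts)) 0 ≠ 0 ↔
        Structure.RelMap R fun i => (ts i).realize (Sum.elim v xs)))
    (hM : ∀ nd ∈ ndsF φ, encode nd < M) : goodF σ b Y φ := by
  induction hφ with
  | falsum => trivial
  | of_isAtomic h =>
    cases h with
    | equal t₁ t₂ =>
      refine ⟨goodT_of σ M hc Y _ t₁ hY fun nd h => hM nd ?_,
        goodT_of σ M hc Y _ t₂ hY fun nd h => hM nd ?_⟩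
      · exact List.mem_append_left _ h
      · exact List.mem_append_right _ h
    | @rel k R ts =>
      have hi : ∀ i, ∀ nd ∈ ndsT (ts i), encode nd < M := by
        intro i nd h
        refine hM nd ?_
        change nd ∈ _ :: _
        rw [List.mem_cons, List.mem_flatMap]
        exact Or.inr ⟨i, List.mem_finRange i, h⟩
      refine ⟨fun R' hR => ?_, fun i => goodT_of σ M hc Y _ _ hY (hi i)⟩
      rw [hb R ts (hM _ (List.mem_cons_self ..)), hc.cR R R' hR]
      have : (fun i => (ts i).realize (Sum.elim v xs)) = fun i => Y (encode (nodeT (ts i))) := by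
        funext i
        rw [hY _ (hi i _ (nodeT_mem _))]
      rw [this]
  | imp _ _ h₁ h₂ =>
    exact ⟨h₁ fun nd h => hM nd (List.mem_append_left _ h),
      h₂ fun nd h => hM nd (List.mem_append_right _ h)⟩

end sem

section two
variable {L₁ : FirstOrder.Language.{0, 0}} [∀ n, Encodable (L₁.Functions n)]
  [∀ n, Encodable (L₁.Relations n)]
variable {L₂ : FirstOrder.Language.{0, 0}} [∀ n, Encodable (L₂.Functions n)]
  [∀ n, Encodable (L₂.Relations n)]
variable {s₁ s₂ : ℕ} (σ₁ : Side L L₁ s₁) (σ₂ : Side L L₂ s₂)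
variable {N : Type} [L.Structure N] [L₁.Structure N] [L₂.Structure N]

/-- Every symbol of `L` belongs to one of the two sides. -/
structure Cover : Prop where
  vF : ∀ {k : ℕ} (f : L.Functions k), (∃ f', σ₁.pF f = some f') ∨ ∃ f', σ₂.pF f = some f'
  vR : ∀ {k : ℕ} (f : L.Relations k), (∃ f', σ₁.pR f = some f') ∨ ∃ f', σ₂.pR f = some f'

theorem realize_of_good (hv : Cover σ₁ σ₂) (hc₁ : Compat σ₁ N) (hc₂ : Compat σ₂ N)
    (Y : ℕ → N) (v : Empty ⊕ Fin n → N) (t : L.Term (Empty ⊕ Fin n))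
    (hx : ∀ x, encode (nodeT (Term.var x : L.Term (Empty ⊕ Fin n))) < M →
      v x = Y (encode (nodeT (Term.var x : L.Term (Empty ⊕ Fin n)))))
    (h₁ : goodT σ₁ Y t) (h₂ : goodT σ₂ Y t) (hM : ∀ nd ∈ ndsT t, encode nd < M) :
    t.realize v = Y (encode (nodeT t)) := by
  induction t with
  | var x => exact hx x (hM _ (nodeT_mem _))
  | @func k f ts ih =>
    have hi : ∀ i, ∀ nd ∈ ndsT (ts i), encode nd < M := by
      intro i nd h
      refine hM nd ?_
      rw [ndsT, List.mem_cons, List.mem_flatMap]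
      exact Or.inr ⟨i, List.mem_finRange i, h⟩
    have : (fun i => (ts i).realize v) = fun i => Y (encode (nodeT (ts i))) :=
      funext fun i => ih i (h₁.2 i) (h₂.2 i) (hi i)
    rw [Term.realize, this]
    rcases hv.vF f with ⟨f', hf⟩ | ⟨f', hf⟩
    · rw [hc₁.cF f f' hf, h₁.1 f' hf]
    · rw [hc₂.cF f f' hf, h₂.1 f' hf]

/-- Evaluation agrees with realization. -/
theorem evF_iff (hv : Cover σ₁ σ₂) (hc₁ : Compat σ₁ N) (hc₂ : Compat σ₂ N)
    (e b : List ℕ) (Y : ℕ → N) (v : Empty → N) (xs : Fin n → N)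
    (φ : L.BoundedFormula Empty n) (hφ : φ.IsQF)
    (hx : ∀ x, encode (nodeT (Term.var x : L.Term (Empty ⊕ Fin n))) < M →
      Sum.elim v xs x = Y (encode (nodeT (Term.var x : L.Term (Empty ⊕ Fin n)))))
    (he : ∀ p < M, ∀ q < M, e.getD p 0 = e.getD q 0 ↔ Y p = Y q)
    (h₁ : goodF σ₁ b Y φ) (h₂ : goodF σ₂ b Y φ) (hM : ∀ nd ∈ ndsF φ, encode nd < M) :
    evF e b φ ≠ 0 ↔ φ.Realize v xs := by
  induction hφ with
  | falsum => simp [evF, BoundedFormula.Realize]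
  | of_isAtomic h =>
    cases h with
    | equal t₁ t₂ =>
      have a₁ : ∀ nd ∈ ndsT t₁, encode nd < M := fun nd h => hM nd (List.mem_append_left _ h)
      have a₂ : ∀ nd ∈ ndsT t₂, encode nd < M := fun nd h => hM nd (List.mem_append_right _ h)
      change (if e.getD (encode (nodeT t₁)) 0 = e.getD (encode (nodeT t₂)) 0 then 1 else 0) ≠ 0 ↔
        t₁.realize (Sum.elim v xs) = t₂.realize (Sum.elim v xs)
      rw [realize_of_good M σ₁ σ₂ hv hc₁ hc₂ Y _ t₁ hx h₁.1 h₂.1 a₁,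
        realize_of_good M σ₁ σ₂ hv hc₁ hc₂ Y _ t₂ hx h₁.2 h₂.2 a₂,
        ← he _ (a₁ _ (nodeT_mem _)) _ (a₂ _ (nodeT_mem _))]
      split_ifs with h <;> simp [-List.getD_eq_getElem?_getD, h]
    | @rel k R ts =>
      have hi : ∀ i, ∀ nd ∈ ndsT (ts i), encode nd < M := by
        intro i nd h
        refine hM nd ?_
        change nd ∈ _ :: _
        rw [List.mem_cons, List.mem_flatMap]
        exact Or.inr ⟨i, List.mem_finRange i, h⟩
      change b.getD (encode (nodeR R ts)) 0 ≠ 0 ↔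
        Structure.RelMap R fun i => (ts i).realize (Sum.elim v xs)
      have : (fun i => (ts i).realize (Sum.elim v xs)) = fun i => Y (encode (nodeT (ts i))) :=
        funext fun i =>
          realize_of_good M σ₁ σ₂ hv hc₁ hc₂ Y _ (ts i) hx (h₁.2 i) (h₂.2 i) (hi i)
      rw [this]
      rcases hv.vR R with ⟨R', hR⟩ | ⟨R', hR⟩
      · rw [hc₁.cR R R' hR, h₁.1 R' hR]
      · rw [hc₂.cR R R' hR, h₂.1 R' hR]
  | @imp φ₁ φ₂ _ _ i₁ i₂ =>
    have j₁ := i₁ h₁.1 h₂.1 fun nd h => hM nd (List.mem_append_left _ h)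
    have j₂ := i₂ h₁.2 h₂.2 fun nd h => hM nd (List.mem_append_right _ h)
    rw [BoundedFormula.realize_imp, ← j₁, ← j₂]
    change (if evF e b φ₁ = 0 then 1 else evF e b φ₂) ≠ 0 ↔ _
    split_ifs with h <;> simp [h]

/-- From a counterexample, extract an arrangement and truth values. -/
theorem complete_part (hv : Cover σ₁ σ₂) (hc₁ : Compat σ₁ N) (hc₂ : Compat σ₂ N)
    (v : Empty → N) (xs : Fin n → N) (a₀ : N)
    (φ : L.BoundedFormula Empty n) (hφ : φ.IsQF) (hM : ∀ nd ∈ ndsF φ, encode nd < M)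
    (hn : ¬ φ.Realize v xs) :
    ∃ e b : List ℕ, (e.length = M ∧ ∀ a ∈ e, a < M) ∧ (b.length = M ∧ ∀ a ∈ b, a < 2) ∧
      evF e b φ = 0 ∧ ∃ ys : Fin M → N, (∀ ℓ ∈ lits σ₁ M e b φ, ℓ.Realize v ys) ∧
        ∀ ℓ ∈ lits σ₂ M e b φ, ℓ.Realize v ys := by
  classical
  let val : ℕ → N := fun p =>
    if h : ∃ t : L.Term (Empty ⊕ Fin n), encode (nodeT t) = p then
      h.choose.realize (Sum.elim v xs) else a₀
  have hval : ∀ t : L.Term (Empty ⊕ Fin n), val (encode (nodeT t)) = t.realize (Sum.elim v xs) := by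
    intro t
    have h : ∃ t' : L.Term (Empty ⊕ Fin n), encode (nodeT t') = encode (nodeT t) := ⟨t, rfl⟩
    simp only [val, dif_pos h]
    rw [nodeT_inj _ _ (encode_injective h.choose_spec)]
  let e : List ℕ := (List.range M).map fun p => sInf {q | val q = val p}
  let B : ℕ → Prop := fun p => ∃ (k : ℕ) (R : L.Relations k)
    (ts : Fin k → L.Term (Empty ⊕ Fin n)), encode (nodeR R ts) = p ∧
      Structure.RelMap R fun i => (ts i).realize (Sum.elim v xs)
  let b : List ℕ := (List.range M).map fun p => if B p then 1 else 0
  let ys : Fin M → N := fun i => val i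
  let Y : ℕ → N := fun p => ys (Fin.ofNat M p)
  have hYv : ∀ p < M, Y p = val p := by
    intro p hp
    change val (p % M) = val p
    rw [Nat.mod_eq_of_lt hp]
  have gete : ∀ p < M, e.getD p 0 = sInf {q | val q = val p} := by
    intro p hp
    simp [e, List.getD_eq_getElem?_getD, hp]
  have getb : ∀ p < M, b.getD p 0 = if B p then 1 else 0 := by
    intro p hp
    simp [b, List.getD_eq_getElem?_getD, hp]
  have hmin : ∀ p, val (sInf {q | val q = val p}) = val p := fun p =>
    Nat.sInf_mem (s := {q | val q = val p}) ⟨p, rfl⟩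
  have he : ∀ p < M, ∀ q < M, e.getD p 0 = e.getD q 0 ↔ Y p = Y q := by
    intro p hp q hq
    rw [gete p hp, gete q hq, hYv p hp, hYv q hq]
    constructor
    · intro h
      rw [← hmin p, ← hmin q, h]
    · intro h
      rw [h]
  have hY : ∀ t : L.Term (Empty ⊕ Fin n), encode (nodeT t) < M →
      Y (encode (nodeT t)) = t.realize (Sum.elim v xs) := by
    intro t ht
    rw [hYv _ ht, hval]
  have hb : ∀ {k : ℕ} (R : L.Relations k) (ts : Fin k → L.Term (Empty ⊕ Fin n)),
      encode (nodeR R ts) < M → (b.getD (encode (nodeR R ts)) 0 ≠ 0 ↔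
        Structure.RelMap R fun i => (ts i).realize (Sum.elim v xs)) := by
    intro k R ts h
    rw [getb _ h]
    have : B (encode (nodeR R ts)) ↔
        Structure.RelMap R fun i => (ts i).realize (Sum.elim v xs) := by
      constructor
      · rintro ⟨k', R', ts', h1, h2⟩
        obtain ⟨rfl, h3, h4⟩ := nodeR_inj _ _ _ _ (encode_injective h1)
        obtain rfl : R' = R := h3
        have : ts' = ts := funext h4
        rwa [this] at h2
      · exact fun h => ⟨k, R, ts, rfl, h⟩
    rw [← this]
    split_ifs with h <;> simp [h]
  have g₁ : goodF σ₁ b Y φ := goodF_of σ₁ M hc₁ b Y v xs φ hφ hY hb hM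
  have g₂ : goodF σ₂ b Y φ := goodF_of σ₂ M hc₂ b Y v xs φ hφ hY hb hM
  refine ⟨e, b, ⟨by simp [e], ?_⟩, ⟨by simp [b], ?_⟩, ?_, ys, ?_, ?_⟩
  · intro a ha
    obtain ⟨p, hp, rfl⟩ := List.mem_map.1 ha
    exact lt_of_le_of_lt (Nat.sInf_le rfl) (List.mem_range.1 hp)
  · intro a ha
    obtain ⟨p, hp, rfl⟩ := List.mem_map.1 ha
    split_ifs <;> simp
  · by_contra h
    exact hn ((evF_iff M σ₁ σ₂ hv hc₁ hc₂ e b Y v xs φ hφ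
      (fun x hx => (hY _ hx).symm) he g₁ g₂ hM).1 h)
  · exact (realize_lits σ₁ M e b v ys φ).2 ⟨he, g₁⟩
  · exact (realize_lits σ₂ M e b v ys φ).2 ⟨he, g₂⟩

end two
end
end NO
end Paper
set_option linter.unusedSectionVars false
namespace Paper
namespace NO

open Encodable FirstOrder Language

section
variable {L' : FirstOrder.Language.{0, 0}} [∀ n, Encodable (L'.Functions n)]
  [∀ n, Encodable (L'.Relations n)]

theorem exists_formula {M : ℕ} (ψ : L'.BoundedFormula Empty M) (h : ψ.IsQF) :
    ∃ θ : L'.Formula (Fin M), θ.IsQF ∧ ∀ (N : Type) [L'.Structure N] (v : Empty → N)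
      (xs : Fin M → N), θ.Realize xs ↔ ψ.Realize v xs := by
  have key : ∀ (N : Type) [L'.Structure N] (v : Empty → N) (xs : Fin M → N)
      (t : L'.Term (Empty ⊕ Fin M)),
      (t.relabel (Sum.elim Empty.elim id : Empty ⊕ Fin M → Fin M)).realize xs =
        t.realize (Sum.elim v xs) := by
    intro N _ v xs t
    rw [Term.realize_relabel]
    congr 1
    funext x
    rcases x with x | x
    · exact x.elim
    · rfl
  induction h with
  | falsum => exact ⟨⊥, .falsum, fun N _ v xs => Iff.rfl⟩
  | of_isAtomic h =>
    cases h with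
    | equal t₁ t₂ =>
      refine ⟨Term.equal (t₁.relabel (Sum.elim Empty.elim id)) (t₂.relabel (Sum.elim Empty.elim id)),
        (BoundedFormula.IsAtomic.equal _ _).isQF, fun N _ v xs => ?_⟩
      rw [Formula.realize_equal, key N v xs, key N v xs]
      rfl
    | rel R ts =>
      refine ⟨Relations.formula R fun i => (ts i).relabel (Sum.elim Empty.elim id),
        (BoundedFormula.IsAtomic.rel _ _).isQF, fun N _ v xs => ?_⟩
      rw [Formula.realize_rel]
      simp only [key N v xs]
      rfl
  | imp _ _ h₁ h₂ =>
    obtain ⟨θ₁, q₁, r₁⟩ := h₁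
    obtain ⟨θ₂, q₂, r₂⟩ := h₂
    refine ⟨θ₁.imp θ₂, q₁.imp q₂, fun N _ v xs => ?_⟩
    rw [Formula.realize_imp, r₁ N v xs, r₂ N v xs, BoundedFormula.realize_imp]

theorem card_le : L'.card ≤ Cardinal.aleph0 := by
  have : Countable L'.Symbols := by
    unfold FirstOrder.Language.Symbols
    infer_instance
  exact Cardinal.mk_le_aleph0

/-- Stable infiniteness plus downward Löwenheim–Skolem. -/
theorem exists_countable_model {M : ℕ} {T : L'.Theory} (hst : StablyInfinite T)
    (l : List (L'.BoundedFormula Empty M)) (hl : ∀ ℓ ∈ l, ℓ.IsQF)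
    (h : ¬ T ⊨ᵇ ((imps l).alls : L'.Sentence)) :
    ∃ (N : Type) (_ : L'.Structure N), N ⊨ T ∧ Cardinal.mk N = Cardinal.aleph0 ∧
      ∃ ys : Fin M → N, ∀ (v : Empty → N), ∀ ℓ ∈ l, ℓ.Realize v ys := by
  rw [Theory.models_sentence_iff] at h
  push Not at h
  obtain ⟨N, hN⟩ := h
  have hN' : ¬ ∀ xs : Fin M → N, (imps l).Realize (default : Empty → N) xs := fun h =>
    hN (BoundedFormula.realize_alls.2 h)
  push Not at hN'
  obtain ⟨xs, hxs⟩ := hN'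
  obtain ⟨θ, q, r⟩ := exists_formula (imps l) (imps_QF l hl)
  obtain ⟨N₁, S₁, hT, hinf, ys, hys⟩ := hst M θ.not q.not
    ⟨N, inferInstance, fun ψ hψ => Theory.realize_sentence_of_mem T hψ, xs,
      fun h => hxs ((r N default xs).1 h)⟩
  let := S₁
  have : N₁ ⊨ T := ⟨fun ψ h => hT ψ h⟩
  obtain ⟨S, hS, hc⟩ := exists_elementarySubstructure_card_eq L' (M := N₁) (Set.range ys)
    Cardinal.aleph0.{0} le_rfl (by simpa using (Set.finite_range ys).countable.le_aleph0)
    (by simpa using card_le) (by simpa using Cardinal.aleph0_le_mk N₁)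
  refine ⟨S, inferInstance, inferInstance, by simpa using hc,
    fun i => ⟨ys i, hS ⟨i, rfl⟩⟩, ?_⟩
  intro v ℓ hℓ
  have h1 : ¬ (imps l).Realize (S.subtype ∘ v) ys := fun h => hys ((r N₁ _ ys).2 h)
  rw [realize_imps, not_not] at h1
  have := h1 ℓ hℓ
  rw [← S.subtype.map_boundedFormula]
  exact this

end

section
variable (L₁ L₂ : FirstOrder.Language.{0, 0})
  [∀ n, Encodable (L₁.Functions n)] [∀ n, Encodable (L₁.Relations n)]
  [∀ n, Encodable (L₂.Functions n)] [∀ n, Encodable (L₂.Relations n)]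

def side₁ : Side (L₁.sum L₂) L₁ 0 where
  pF f := Sum.elim some (fun _ => none) f
  pR f := Sum.elim some (fun _ => none) f
  hF := by
    rintro k (f | f) f' h
    · obtain rfl := Option.some.inj h
      change (2 * encode f) % 2 = 0 ∧ (2 * encode f) / 2 = encode f
      omega
    · cases h
  hR := by
    rintro k (f | f) f' h
    · obtain rfl := Option.some.inj h
      change (2 * encode f) % 2 = 0 ∧ (2 * encode f) / 2 = encode f
      omega
    · cases h
  nF := by
    rintro k (f | f) h
    · cases h
    · change (2 * encode f + 1) % 2 ≠ 0
      omega
  nR := by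
    rintro k (f | f) h
    · cases h
    · change (2 * encode f + 1) % 2 ≠ 0
      omega

def side₂ : Side (L₁.sum L₂) L₂ 1 where
  pF f := Sum.elim (fun _ => none) some f
  pR f := Sum.elim (fun _ => none) some f
  hF := by
    rintro k (f | f) f' h
    · cases h
    · obtain rfl := Option.some.inj h
      change (2 * encode f + 1) % 2 = 1 ∧ (2 * encode f + 1) / 2 = encode f
      omega
  hR := by
    rintro k (f | f) f' h
    · cases h
    · obtain rfl := Option.some.inj h
      change (2 * encode f + 1) % 2 = 1 ∧ (2 * encode f + 1) / 2 = encode f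
      omega
  nF := by
    rintro k (f | f) h
    · change (2 * encode f) % 2 ≠ 1
      omega
    · cases h
  nR := by
    rintro k (f | f) h
    · change (2 * encode f) % 2 ≠ 1
      omega
    · cases h

theorem cover : Cover (side₁ L₁ L₂) (side₂ L₁ L₂) where
  vF := by
    rintro k (f | f)
    · exact Or.inl ⟨f, rfl⟩
    · exact Or.inr ⟨f, rfl⟩
  vR := by
    rintro k (f | f)
    · exact Or.inl ⟨f, rfl⟩
    · exact Or.inr ⟨f, rfl⟩

theorem compat₁ (N : Type) [L₁.Structure N] [(L₁.sum L₂).Structure N]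
    [h : (LHom.sumInl : L₁ →ᴸ L₁.sum L₂).IsExpansionOn N] : Compat (side₁ L₁ L₂) N where
  cF := by
    rintro k (f | f) f' h'
    · obtain rfl := Option.some.inj h'
      exact fun x => h.map_onFunction f x
    · cases h'
  cR := by
    rintro k (f | f) f' h'
    · obtain rfl := Option.some.inj h'
      exact fun x => Iff.of_eq (h.map_onRelation f x)
    · cases h'

theorem compat₂ (N : Type) [L₂.Structure N] [(L₁.sum L₂).Structure N]
    [h : (LHom.sumInr : L₂ →ᴸ L₁.sum L₂).IsExpansionOn N] : Compat (side₂ L₁ L₂) N where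
  cF := by
    rintro k (f | f) f' h'
    · cases h'
    · obtain rfl := Option.some.inj h'
      exact fun x => h.map_onFunction f x
  cR := by
    rintro k (f | f) f' h'
    · cases h'
    · obtain rfl := Option.some.inj h'
      exact fun x => Iff.of_eq (h.map_onRelation f x)

variable {L₁ L₂} (T₁ : L₁.Theory) (T₂ : L₂.Theory)

def unionT : (L₁.sum L₂).Theory := LHom.sumInl.onTheory T₁ ∪ LHom.sumInr.onTheory T₂

theorem soundness (hst₁ : StablyInfinite T₁) (hst₂ : StablyInfinite T₂) {n : ℕ}
    (φ : (L₁.sum L₂).BoundedFormula Empty n) (hφ : φ.IsQF) (M : ℕ) [NeZero M]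
    (hM : ∀ nd ∈ ndsF φ, encode nd < M) (e b : List ℕ)
    (hT : unionT T₁ T₂ ⊨ᵇ (φ.alls : (L₁.sum L₂).Sentence)) (hev : evF e b φ = 0) :
    T₁ ⊨ᵇ ((imps (lits (side₁ L₁ L₂) M e b φ)).alls : L₁.Sentence) ∨
    T₂ ⊨ᵇ ((imps (lits (side₂ L₁ L₂) M e b φ)).alls : L₂.Sentence) := by
  by_contra hcon
  push Not at hcon
  obtain ⟨N₁, S₁, m₁, c₁, y₁, r₁⟩ := exists_countable_model hst₁ _ (lits_QF _ M e b φ) hcon.1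
  obtain ⟨N₂, S₂, m₂, c₂, y₂, r₂⟩ := exists_countable_model hst₂ _ (lits_QF _ M e b φ) hcon.2
  have k₁ := ((realize_lits _ M e b (default : Empty → N₁) y₁ φ).1 (r₁ _)).1
  have k₂ := ((realize_lits _ M e b (default : Empty → N₂) y₂ φ).1 (r₂ _)).1
  have ker : ∀ i j, y₁ i = y₁ j ↔ y₂ i = y₂ j := by
    intro i j
    have a := k₁ i i.2 j j.2
    have b := k₂ i i.2 j j.2
    simp only [Fin.ofNat_eq_cast, Fin.cast_val_eq_self] at a b
    rw [← a, ← b]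
  -- the bijection
  choose g hg using fun x : Set.range y₂ => x.2
  obtain ⟨G, hG⟩ := Cardinal.extend_function_of_lt (s := Set.range y₂)
    ⟨fun x => y₁ (g x), fun x x' h => by
      have := (ker _ _).1 h
      rw [hg, hg] at this
      exact Subtype.ext this⟩
    (by rw [c₂]; exact (Set.finite_range y₂).lt_aleph0)
    (Cardinal.eq.1 (c₂.trans c₁.symm))
  have hGy : ∀ i, G (y₂ i) = y₁ i := by
    intro i
    have := hG ⟨y₂ i, i, rfl⟩
    rw [this]
    exact (ker _ _).2 (hg ⟨y₂ i, i, rfl⟩)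
  let : L₂.Structure N₁ := G.inducedStructure
  let GE : N₂ ≃[L₂] N₁ := G.inducedStructureEquiv
  have m₂' : N₁ ⊨ T₂ := StrongHomClass.theory_model GE
  have m : N₁ ⊨ unionT T₁ T₂ :=
    Theory.Model.union ((LHom.onTheory_model _ _).2 m₁) ((LHom.onTheory_model _ _).2 m₂')
  have : Nonempty N₁ := ⟨y₁ 0⟩
  have hre := hT.realize_sentence N₁
  have r₂' : ∀ ℓ ∈ lits (side₂ L₁ L₂) M e b φ, ℓ.Realize (default : Empty → N₁) y₁ := by
    intro ℓ hℓ
    have := (StrongHomClass.realize_boundedFormula GE ℓ).2 (r₂ default ℓ hℓ)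
    have h1 : GE ∘ y₂ = y₁ := funext hGy
    rwa [h1, Unique.eq_default (GE ∘ default)] at this
  have A₁ := (realize_lits (side₁ L₁ L₂) M e b (default : Empty → N₁) y₁ φ).1 (r₁ _)
  have A₂ := (realize_lits (side₂ L₁ L₂) M e b (default : Empty → N₁) y₁ φ).1 r₂'
  have := (evF_iff M (side₁ L₁ L₂) (side₂ L₁ L₂) (cover L₁ L₂) (compat₁ L₁ L₂ N₁)
    (compat₂ L₁ L₂ N₁) e b (fun p => y₁ (Fin.ofNat M p)) default
    (fun i => y₁ (Fin.ofNat M (encode (nodeT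
      (Term.var (Sum.inr i) : (L₁.sum L₂).Term (Empty ⊕ Fin n)))))) φ hφ
    (by
      rintro (x | x) hx
      · exact x.elim
      · rfl) A₁.1 A₁.2 A₂.2 hM).2 (BoundedFormula.realize_alls.1 hre _)
  exact this hev

theorem completeness {n : ℕ}
    (φ : (L₁.sum L₂).BoundedFormula Empty n) (hφ : φ.IsQF) (M : ℕ) [NeZero M]
    (hM : ∀ nd ∈ ndsF φ, encode nd < M)
    (hT : ¬ unionT T₁ T₂ ⊨ᵇ (φ.alls : (L₁.sum L₂).Sentence)) :
    ∃ e b : List ℕ, (e.length = M ∧ ∀ a ∈ e, a < M) ∧ (b.length = M ∧ ∀ a ∈ b, a < 2) ∧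
      evF e b φ = 0 ∧
    ¬ T₁ ⊨ᵇ ((imps (lits (side₁ L₁ L₂) M e b φ)).alls : L₁.Sentence) ∧
    ¬ T₂ ⊨ᵇ ((imps (lits (side₂ L₁ L₂) M e b φ)).alls : L₂.Sentence) := by
  rw [Theory.models_sentence_iff] at hT
  push Not at hT
  obtain ⟨N, hN⟩ := hT
  have hN' : ¬ ∀ xs : Fin n → N, φ.Realize (default : Empty → N) xs := fun h =>
    hN (BoundedFormula.realize_alls.2 h)
  push Not at hN'
  obtain ⟨xs, hxs⟩ := hN'
  let : L₁.Structure N := (LHom.sumInl : L₁ →ᴸ L₁.sum L₂).reduct N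
  let : L₂.Structure N := (LHom.sumInr : L₂ →ᴸ L₁.sum L₂).reduct N
  have hm : N ⊨ unionT T₁ T₂ := N.is_model
  have i₁ : (LHom.sumInl : L₁ →ᴸ L₁.sum L₂).IsExpansionOn N := LHom.isExpansionOn_reduct _ _
  have i₂ : (LHom.sumInr : L₂ →ᴸ L₁.sum L₂).IsExpansionOn N := LHom.isExpansionOn_reduct _ _
  have m₁ : N ⊨ T₁ := (LHom.onTheory_model (LHom.sumInl : L₁ →ᴸ L₁.sum L₂) T₁).1
    (Theory.Model.mono hm Set.subset_union_left)
  have m₂ : N ⊨ T₂ := (LHom.onTheory_model (LHom.sumInr : L₂ →ᴸ L₁.sum L₂) T₂).1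
    (Theory.Model.mono hm Set.subset_union_right)
  obtain ⟨e, b, he, hb, hev, ys, h₁, h₂⟩ := complete_part M (side₁ L₁ L₂) (side₂ L₁ L₂)
    (cover L₁ L₂) (compat₁ L₁ L₂ N) (compat₂ L₁ L₂ N) default xs (Classical.arbitrary N) φ hφ hM hxs
  refine ⟨e, b, he, hb, hev, fun h => ?_, fun h => ?_⟩
  · exact (realize_imps _ _ _).1 (BoundedFormula.realize_alls.1 (h.realize_sentence N) ys) h₁
  · exact (realize_imps _ _ _).1 (BoundedFormula.realize_alls.1 (h.realize_sentence N) ys) h₂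

instance neZero_bound (nds : List Node) : NeZero (bound nds) := ⟨by unfold bound; omega⟩

theorem main (hst₁ : StablyInfinite T₁) (hst₂ : StablyInfinite T₂)
    (hdec₁ : DecidableVia (univFragment T₁)) (hdec₂ : DecidableVia (univFragment T₂)) :
    DecidableVia (univFragment (unionT T₁ T₂)) := by
  obtain ⟨f₁, hf₁, d₁⟩ := hdec₁
  obtain ⟨f₂, hf₂, d₂⟩ := hdec₂
  refine ⟨decider f₁ f₂, comp_decider hf₁ hf₂, fun φ => ?_⟩
  rw [decider_iff, ← univ_iff]
  change IsUniversalSentence φ ∧ _ ↔ _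
  refine and_congr_right ?_
  rintro ⟨n, ψ, hψ, rfl⟩
  have out₁ : ∀ e b, f₁ (encode (outToks 0 (bound (ndsF ψ)) e b (ndsF ψ))) = true ↔
      T₁ ⊨ᵇ ((imps (lits (side₁ L₁ L₂) (bound (ndsF ψ)) e b ψ)).alls : L₁.Sentence) := by
    intro e b
    rw [encode_out (side₁ L₁ L₂), ← d₁]
    exact and_iff_right ⟨_, _, imps_QF _ (lits_QF _ _ e b ψ), rfl⟩
  have out₂ : ∀ e b, f₂ (encode (outToks 1 (bound (ndsF ψ)) e b (ndsF ψ))) = true ↔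
      T₂ ⊨ᵇ ((imps (lits (side₂ L₁ L₂) (bound (ndsF ψ)) e b ψ)).alls : L₂.Sentence) := by
    intro e b
    rw [encode_out (side₂ L₁ L₂), ← d₂]
    exact and_iff_right ⟨_, _, imps_QF _ (lits_QF _ _ e b ψ), rfl⟩
  simp only [ndsF_alls, evF_alls, out₁, out₂]
  have hM : ∀ nd ∈ ndsF ψ, encode nd < bound (ndsF ψ) := fun nd h => lt_bound h
  constructor
  · intro h e b _ _ hev
    exact soundness T₁ T₂ hst₁ hst₂ ψ hψ _ hM e b h hev
  · intro h
    by_contra hcon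
    obtain ⟨e, b, he, hb, hev, h₁, h₂⟩ := completeness T₁ T₂ ψ hψ _ hM hcon
    exact (h e b he hb hev).elim h₁ h₂

end
end NO
end Paper

namespace Paper

open FirstOrder Language

section

variable (L₁ L₂ : Language)
  [∀ n, Encodable (L₁.Functions n)] [∀ n, Encodable (L₁.Relations n)]
  [∀ n, Encodable (L₂.Functions n)] [∀ n, Encodable (L₂.Relations n)]

/-- **Nelson–Oppen combination** (Theorem 2.1).  If `T₁` and `T₂` are stably infinite
theories in (effectively presented) languages that are disjoint except for equality, and the
universal fragments of `T₁` and `T₂` are decidable, then the universal fragment of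
`T₁ ∪ T₂` is decidable.  The disjoint union of the two languages is realized as the sum
language `L₁.sum L₂`. -/
theorem nelsonOppen_decidable_univFragment_union
    (T₁ : L₁.Theory) (T₂ : L₂.Theory)
    (hst₁ : StablyInfinite T₁) (hst₂ : StablyInfinite T₂)
    (hdec₁ : DecidableVia (univFragment T₁)) (hdec₂ : DecidableVia (univFragment T₂)) :
    DecidableVia (univFragment
      ((LHom.sumInl.onTheory T₁ ∪ LHom.sumInr.onTheory T₂ : (L₁.sum L₂).Theory))) := by
  exact NO.main T₁ T₂ hst₁ hst₂ hdec₁ hdec₂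

end

end Paper
end

section
/- The first-order theory of the structure (ℝ; 0, 1, −1, ×, ÷, <), where x ÷ y is interpreted as the usual quotient for y ≠ 0 and x ÷ 0 is interpreted as 0, admits elimination of quantifiers: every formula is equivalent over this structure to a quantifier-free formula in the same free variables. Consequently this theory is decidable. -/
namespace Paper

open FirstOrder Language

/-- The language with constants `0, 1, -1`, binary functions `×, ÷`, and the relation `<`.
Constants are indexed by `Fin 3` (`0 ↦ 0`, `1 ↦ 1`, `2 ↦ -1`) and binary functions by
`Fin 2` (`0 ↦ ×`, `1 ↦ ÷`). -/
@[reducible] def divLang : Language where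
  Functions
    | 0 => Fin 3
    | 2 => Fin 2
    | 1 => Empty
    | _ + 3 => Empty
  Relations
    | 2 => Unit
    | _ => Empty

/-- The intended interpretation in `ℝ`, with the convention `x ÷ 0 = 0` (which is Lean's
convention for `x / 0`). -/
noncomputable instance divStructure : divLang.Structure ℝ where
  funMap {n} f x :=
    match n, f, x with
    | 0, i, _ => if i = 0 then (0 : ℝ) else if i = 1 then 1 else -1
    | 1, f, _ => f.elim
    | 2, i, x => if i = 0 then x 0 * x 1 else x 0 / x 1
    | _ + 3, f, _ => f.elim
  RelMap {n} r x :=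
    match n, r, x with
    | 0, r, _ => r.elim
    | 1, r, _ => r.elim
    | 2, _, x => x 0 < x 1
    | _ + 3, r, _ => r.elim

instance divFunctionsEncodable : ∀ n, Encodable (divLang.Functions n)
  | 0 => inferInstanceAs (Encodable (Fin 3))
  | 1 => inferInstanceAs (Encodable Empty)
  | 2 => inferInstanceAs (Encodable (Fin 2))
  | _ + 3 => inferInstanceAs (Encodable Empty)

instance divRelationsEncodable : ∀ n, Encodable (divLang.Relations n)
  | 0 => inferInstanceAs (Encodable Empty)
  | 1 => inferInstanceAs (Encodable Empty)
  | 2 => inferInstanceAs (Encodable Unit)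
  | _ + 3 => inferInstanceAs (Encodable Empty)

end Paper

namespace Paper

open FirstOrder Language

/-! ### Linear part -/

theorem testpoint {I : Type*} [Finite I] [Nonempty I] (f g : I → ℝ)
    (h : ∀ i j, f i < f j ↔ g i < g j) (a : ℝ) :
    ∃ b, (∀ i, (f i < a ↔ g i < b) ∧ (a < f i ↔ b < g i)) ∧
      ((∃ i j, b = (g i + g j) / 2) ∨ ∃ i, b = g i + 1 ∨ b = g i - 1) := by
  classical
  have _ := Fintype.ofFinite I
  have hle : ∀ i j, f i ≤ f j ↔ g i ≤ g j := fun i j => by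
    rw [← not_lt, ← not_lt, h]
  by_cases hex : ∃ i, f i = a
  · obtain ⟨i, rfl⟩ := hex
    exact ⟨g i, fun j => ⟨h _ _, h _ _⟩, Or.inl ⟨i, i, by ring⟩⟩
  push Not at hex
  set Lo := Finset.univ.filter (fun i => f i < a) with hLo
  set Hi := Finset.univ.filter (fun i => a < f i) with hHi
  by_cases h1 : Lo.Nonempty
  · obtain ⟨p, hp, hpm⟩ := Lo.exists_max_image g h1
    by_cases h2 : Hi.Nonempty
    · obtain ⟨q, hq, hqm⟩ := Hi.exists_min_image g h2
      simp only [hLo, hHi, Finset.mem_filter, Finset.mem_univ, true_and] at hp hq hpm hqm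
      have hpq : g p < g q := (h _ _).1 (hp.trans hq)
      refine ⟨(g p + g q) / 2, fun i => ?_, Or.inl ⟨p, q, rfl⟩⟩
      rcases lt_or_gt_of_ne (hex i) with hi | hi
      · have := hpm i hi
        exact ⟨⟨fun _ => by linarith, fun _ => hi⟩, ⟨fun h => by linarith, fun h => by linarith⟩⟩
      · have := hqm i hi
        exact ⟨⟨fun h => by linarith, fun h => by linarith⟩, ⟨fun h => by linarith, fun h => hi⟩⟩
    · refine ⟨g p + 1, fun i => ?_, Or.inr ⟨p, Or.inl rfl⟩⟩
      have hi : f i < a := by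
        rcases lt_or_gt_of_ne (hex i) with hi | hi
        · exact hi
        · exact absurd ⟨i, by simp [hHi, hi]⟩ h2
      have := hpm i (by simp [hLo, hi])
      exact ⟨⟨fun _ => by linarith, fun _ => hi⟩, ⟨fun h => by linarith, fun h => by linarith⟩⟩
  · have hall : ∀ i, a < f i := fun i => by
      rcases lt_or_gt_of_ne (hex i) with hi | hi
      · exact absurd ⟨i, by simp [hLo, hi]⟩ h1
      · exact hi
    obtain ⟨q, -, hqm⟩ := Finset.univ.exists_min_image g Finset.univ_nonempty
    refine ⟨g q - 1, fun i => ?_, Or.inr ⟨q, Or.inr rfl⟩⟩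
    have := hqm i (Finset.mem_univ _)
    have hi := hall i
    exact ⟨⟨fun h => by linarith, fun h => by linarith⟩, ⟨fun h => by linarith, fun h => hi⟩⟩

/-- Linear forms with integer coefficients bounded by `B` have the same signs. -/
def LinEq {ι : Type*} [Fintype ι] (B : ℕ) (u v : ι → ℝ) : Prop :=
  ∀ c : ι → ℤ, (∀ i, |c i| ≤ B) → (0 < ∑ i, c i * u i ↔ 0 < ∑ i, c i * v i)

theorem LinEq.mono {ι : Type*} [Fintype ι] {B B' : ℕ} {u v : ι → ℝ} (hB : B ≤ B')
    (h : LinEq B' u v) : LinEq B u v :=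
  fun c hc => h c fun i => (hc i).trans (by exact_mod_cast hB)

theorem LinEq.extend {ι : Type*} [Fintype ι] {B : ℕ} (hB : 1 ≤ B) {u v : ι → ℝ}
    (h : LinEq (2 * B ^ 2) u v) (a : ℝ) :
    ∃ b : ℝ, (∀ (c : ι → ℤ) (d : ℤ), (∀ i, |c i| ≤ B) → |d| ≤ B →
        (0 < ∑ i, c i * u i + d * a ↔ 0 < ∑ i, c i * v i + d * b)) ∧
      ∀ Θ : Set ℝ, (∀ (c : ι → ℤ) (d : ℕ), (∀ i, |c i| ≤ B) → 1 ≤ d → d ≤ B →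
        (∑ i, c i * v i) / d ∈ Θ) →
        ((∃ s ∈ Θ, ∃ t ∈ Θ, b = (s + t) / 2) ∨ ∃ s ∈ Θ, b = s + 1 ∨ b = s - 1) := by
  classical
  let I := {c : ι → ℤ // ∀ i, c i ∈ Set.Icc (-(B : ℤ)) B} × {d : ℕ // d ∈ Set.Icc 1 B}
  have hfin : Finite {c : ι → ℤ // ∀ i, c i ∈ Set.Icc (-(B : ℤ)) B} := by
    have : Finite (ι → Set.Icc (-(B : ℤ)) B) := inferInstance
    exact Finite.of_injective (fun c : {c : ι → ℤ // ∀ i, c i ∈ Set.Icc (-(B : ℤ)) B} =>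
      (fun i => (⟨c.1 i, c.2 i⟩ : Set.Icc (-(B : ℤ)) B))) (by
        intro c c' hcc
        ext i
        have := congrFun hcc i
        simpa using this)
  have : Finite I := inferInstance
  have : Nonempty I := ⟨⟨⟨fun _ => 0, by simp⟩, ⟨1, by simp [hB]⟩⟩⟩
  let f : (ι → ℝ) → I → ℝ := fun w p => (∑ i, p.1.1 i * w i) / (p.2.1 : ℝ)
  have key : ∀ i j, f u i < f u j ↔ f v i < f v j := by
    rintro ⟨⟨c, hc⟩, ⟨d, hd⟩⟩ ⟨⟨c', hc'⟩, ⟨d', hd'⟩⟩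
    have e : ∀ w : ι → ℝ, f w ⟨⟨c, hc⟩, ⟨d, hd⟩⟩ < f w ⟨⟨c', hc'⟩, ⟨d', hd'⟩⟩ ↔
        0 < ∑ i, ((d * c' i - d' * c i : ℤ) : ℝ) * w i := by
      intro w
      have h1 : (0 : ℝ) < d := by exact_mod_cast hd.1
      have h2 : (0 : ℝ) < d' := by exact_mod_cast hd'.1
      simp only [f]
      rw [div_lt_div_iff₀ h1 h2, ← sub_pos]
      have : ∑ i, ((d * c' i - d' * c i : ℤ) : ℝ) * w i
          = (∑ i, (c' i : ℝ) * w i) * d - (∑ i, (c i : ℝ) * w i) * d' := by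
        rw [Finset.sum_mul, Finset.sum_mul, ← Finset.sum_sub_distrib]
        refine Finset.sum_congr rfl fun i _ => ?_
        push_cast; ring
      rw [this]
    rw [e, e]
    refine h _ fun i => ?_
    have hd1 : (d : ℤ) ≤ B := by exact_mod_cast hd.2
    have hd2 : (d' : ℤ) ≤ B := by exact_mod_cast hd'.2
    have a1 : |c i| ≤ B := abs_le.2 (hc i)
    have a2 : |c' i| ≤ B := abs_le.2 (hc' i)
    have b1 : (d' : ℤ) * |c i| ≤ B * B := mul_le_mul hd2 a1 (abs_nonneg _) (by positivity)
    have b2 : (d : ℤ) * |c' i| ≤ B * B := mul_le_mul hd1 a2 (abs_nonneg _) (by positivity)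
    calc |(d : ℤ) * c' i - d' * c i| ≤ |(d : ℤ) * c' i| + |(d' : ℤ) * c i| := abs_sub _ _
      _ = d * |c' i| + d' * |c i| := by simp [abs_mul]
      _ ≤ _ := by push_cast; nlinarith
  obtain ⟨b, hb, hb'⟩ := testpoint (f u) (f v) key a
  refine ⟨b, ?_, ?_⟩
  · intro c d hc hd
    rcases lt_trichotomy d 0 with hd0 | rfl | hd0
    · obtain ⟨m, rfl⟩ : ∃ m : ℕ, d = -m := ⟨d.natAbs, by omega⟩
      have hm : (0 : ℝ) < m := by exact_mod_cast (by omega : 0 < m)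
      have := (hb ⟨⟨c, fun i => abs_le.1 (hc i)⟩, ⟨m, by
        rw [abs_neg, Nat.abs_cast] at hd; exact ⟨by omega, by omega⟩⟩⟩).2
      simp only [f] at this
      rw [lt_div_iff₀ hm, lt_div_iff₀ hm] at this
      push_cast
      constructor
      · intro h; linarith [this.1 (by linarith)]
      · intro h; linarith [this.2 (by linarith)]
    · simpa using h c fun i => (hc i).trans (by
        have : B ≤ 2 * B ^ 2 := by nlinarith
        exact_mod_cast this)
    · obtain ⟨m, rfl⟩ : ∃ m : ℕ, d = m := ⟨d.natAbs, by omega⟩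
      have hm : (0 : ℝ) < m := by exact_mod_cast (by omega : 0 < m)
      have := (hb ⟨⟨fun i => -c i, fun i => abs_le.1 (by rw [abs_neg]; exact hc i)⟩, ⟨m, by
        rw [Nat.abs_cast] at hd; exact ⟨by omega, by omega⟩⟩⟩).1
      simp only [f] at this
      rw [div_lt_iff₀ hm, div_lt_iff₀ hm] at this
      simp only [Int.cast_neg, neg_mul, Finset.sum_neg_distrib] at this
      push_cast
      constructor
      · intro h; linarith [this.1 (by linarith)]
      · intro h; linarith [this.2 (by linarith)]
  · intro Θ hΘ
    have hm : ∀ p, f v p ∈ Θ := fun p =>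
      hΘ _ _ (fun i => abs_le.2 (p.1.2 i)) p.2.2.1 p.2.2.2
    rcases hb' with ⟨i, j, e⟩ | ⟨i, e⟩
    · exact Or.inl ⟨_, hm i, _, hm j, e⟩
    · exact Or.inr ⟨_, hm i, e⟩

/-! ### Types -/

def TypeEq {ι : Type*} [Fintype ι] (B : ℕ) (w w' : ι → ℝ) : Prop :=
  (∀ i, SignType.sign (w i) = SignType.sign (w' i)) ∧
    LinEq B (fun i => Real.log (w i)) (fun i => Real.log (w' i))

theorem TypeEq.mono {ι : Type*} [Fintype ι] {B B' : ℕ} {u v : ι → ℝ} (hB : B ≤ B')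
    (h : TypeEq B' u v) : TypeEq B u v := ⟨h.1, h.2.mono hB⟩

theorem LinEq.snoc {α : Type*} [Fintype α] {n B : ℕ} {v v' : α → ℝ} {x x' : Fin n → ℝ} {a b : ℝ}
    (h : ∀ (c : α ⊕ Fin n → ℤ) (d : ℤ), (∀ i, |c i| ≤ B) → |d| ≤ B →
        (0 < ∑ i, c i * (Sum.elim v x i) + d * a ↔ 0 < ∑ i, c i * (Sum.elim v' x' i) + d * b)) :
    LinEq B (Sum.elim v (Fin.snoc x a : Fin (n + 1) → ℝ))
      (Sum.elim v' (Fin.snoc x' b : Fin (n + 1) → ℝ)) := by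
  intro c hc
  have := h (Sum.elim (fun i => c (Sum.inl i)) (fun i => c (Sum.inr i.castSucc)))
    (c (Sum.inr (Fin.last n))) (by rintro (i | i) <;> exact hc _) (hc _)
  simp only [Fintype.sum_sum_type, Fin.sum_univ_castSucc, Sum.elim_inl, Sum.elim_inr,
    Fin.snoc_castSucc, Fin.snoc_last] at this ⊢
  simpa only [add_assoc] using this

theorem log_sumElim {α : Type*} {n : ℕ} (v : α → ℝ) (x : Fin n → ℝ) :
    (fun i => Real.log (Sum.elim v x i)) = Sum.elim (fun i => Real.log (v i))
      (fun i => Real.log (x i)) := by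
  ext i; cases i <;> rfl

theorem log_snoc {n : ℕ} (x : Fin n → ℝ) (a : ℝ) :
    (fun i => Real.log ((Fin.snoc x a : Fin (n + 1) → ℝ) i)) =
      (Fin.snoc (fun i => Real.log (x i)) (Real.log a) : Fin (n + 1) → ℝ) := by
  ext i
  refine Fin.lastCases ?_ (fun i => ?_) i <;> simp

theorem TypeEq.snoc {α : Type*} [Fintype α] {n B : ℕ} {v v' : α → ℝ} {x x' : Fin n → ℝ} {a b : ℝ}
    (hs : ∀ i, SignType.sign (Sum.elim v x i) = SignType.sign (Sum.elim v' x' i))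
    (hab : SignType.sign a = SignType.sign b)
    (h : ∀ (c : α ⊕ Fin n → ℤ) (d : ℤ), (∀ i, |c i| ≤ B) → |d| ≤ B →
        (0 < ∑ i, c i * Real.log (Sum.elim v x i) + d * Real.log a ↔
          0 < ∑ i, c i * Real.log (Sum.elim v' x' i) + d * Real.log b)) :
    TypeEq B (Sum.elim v (Fin.snoc x a : Fin (n + 1) → ℝ))
      (Sum.elim v' (Fin.snoc x' b : Fin (n + 1) → ℝ)) := by
  constructor
  · rintro (i | i)
    · exact hs (Sum.inl i)
    · refine Fin.lastCases ?_ (fun i => ?_) i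
      · simpa using hab
      · simpa using hs (Sum.inr i)
  · rw [log_sumElim, log_sumElim, log_snoc, log_snoc]
    apply LinEq.snoc
    intro c d hc hd
    have := h c d hc hd
    simp only [← log_sumElim]
    exact this

/-- the real number with given sign and logarithm -/
noncomputable def mkR (s : SignType) (l : ℝ) : ℝ := (s : ℝ) * Real.exp l

theorem sign_mkR (s : SignType) (l : ℝ) : SignType.sign (mkR s l) = s := by
  unfold mkR
  rw [sign_mul, sign_pos (Real.exp_pos l), mul_one]
  cases s <;> simp

theorem log_mkR {s : SignType} (hs : s ≠ 0) (l : ℝ) : Real.log (mkR s l) = l := by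
  unfold mkR
  cases s
  · exact absurd rfl hs
  · simp
  · simp

theorem mkR_sign_log (r : ℝ) : mkR (SignType.sign r) (Real.log r) = r := by
  unfold mkR
  rcases lt_trichotomy r 0 with h | rfl | h
  · rw [sign_neg h, Real.exp_log_of_neg h]; simp
  · simp
  · rw [sign_pos h, Real.exp_log h]; simp

theorem TypeEq.extend {α : Type*} [Fintype α] {n B : ℕ} (hB : 1 ≤ B) {v v' : α → ℝ}
    {x x' : Fin n → ℝ} (h : TypeEq (2 * B ^ 2) (Sum.elim v x) (Sum.elim v' x')) (a : ℝ) :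
    ∃ b : ℝ, TypeEq B (Sum.elim v (Fin.snoc x a : Fin (n + 1) → ℝ))
      (Sum.elim v' (Fin.snoc x' b : Fin (n + 1) → ℝ)) := by
  obtain ⟨l, hl, -⟩ := h.2.extend hB (Real.log a)
  by_cases ha : a = 0
  · refine ⟨0, TypeEq.snoc h.1 (by rw [ha]) ?_⟩
    intro c d hc hd
    subst ha
    simpa using h.2 c fun i => (hc i).trans (by
        have : B ≤ 2 * B ^ 2 := by nlinarith
        exact_mod_cast this)
  · refine ⟨mkR (SignType.sign a) l, TypeEq.snoc h.1 (sign_mkR _ _).symm ?_⟩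
    rw [log_mkR (by simpa using ha)]
    exact hl

/-! ### Terms -/

@[simp] theorem fun0 (f : Fin 3) (x : Fin 0 → ℝ) :
    Structure.funMap (L := divLang) (n := 0) f x
      = if f = 0 then (0 : ℝ) else if f = 1 then 1 else -1 := rfl

@[simp] theorem fun2 (f : Fin 2) (x : Fin 2 → ℝ) :
    Structure.funMap (L := divLang) (n := 2) f x = if f = 0 then x 0 * x 1 else x 0 / x 1 := rfl

@[simp] theorem rel2 (f : Unit) (x : Fin 2 → ℝ) :
    Structure.RelMap (L := divLang) (n := 2) f x ↔ x 0 < x 1 := Iff.rfl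

theorem term_spec {ι : Type} [Fintype ι] (t : divLang.Term ι) :
    ∃ (c : ι → ℤ) (g : (ι → SignType) → SignType), (∀ i, |c i| ≤ (t.listEncode.length : ℤ)) ∧
      ∀ w : ι → ℝ, t.realize w =
        mkR (g fun i => SignType.sign (w i)) (∑ i, c i * Real.log (w i)) := by
  classical
  induction t with
  | var i =>
    refine ⟨Pi.single i 1, fun s => s i, ?_, ?_⟩
    · intro j
      simp only [Term.listEncode, List.length_singleton]
      by_cases hj : j = i
      · subst hj; simp
      · simp [hj]
    · intro w
      have : ∑ j, ((Pi.single i 1 : ι → ℤ) j : ℝ) * Real.log (w j) = Real.log (w i) := by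
        rw [Finset.sum_eq_single i] <;> simp +contextual
      rw [this, mkR_sign_log]; rfl
  | @func l f ts ih =>
    match l, f, ts, ih with
    | 0, f, ts, ih =>
      refine ⟨0, fun _ => if f = 0 then 0 else if f = 1 then 1 else -1, by simp, fun w => ?_⟩
      simp only [Term.realize_func, fun0, mkR]
      split_ifs <;> simp
    | 1, f, ts, ih => exact f.elim
    | 2, f, ts, ih =>
      obtain ⟨c, g, hc, hg⟩ := ih 0
      obtain ⟨c', g', hc', hg'⟩ := ih 1
      have hlen : ((Term.func f ts : divLang.Term ι).listEncode.length : ℤ)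
          = 1 + (ts 0).listEncode.length + (ts 1).listEncode.length := by
        simp [Term.listEncode, List.finRange_succ, add_comm, add_assoc]
      simp only [hlen]
      by_cases hf : f = 0
      · refine ⟨fun i => c i + c' i, fun s => g s * g' s, ?_, ?_⟩
        · intro i
          have := abs_add_le (c i) (c' i)
          linarith [hc i, hc' i]
        · intro w
          simp only [Term.realize_func, fun2, hf, if_true, hg, hg', mkR]
          simp only [Int.cast_add, add_mul, Finset.sum_add_distrib, Real.exp_add,
            SignType.coe_mul]
          ring
      · refine ⟨fun i => c i - c' i, fun s => g s * g' s, ?_, ?_⟩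
        · intro i
          have := abs_sub (c i) (c' i)
          linarith [hc i, hc' i]
        · intro w
          simp only [Term.realize_func, fun2, hf, if_false, hg, hg', mkR]
          simp only [Int.cast_sub, sub_mul, Finset.sum_sub_distrib, Real.exp_sub,
            SignType.coe_mul]
          generalize g' _ = s'
          cases s' <;> simp [div_eq_mul_inv] <;> ring
    | _ + 3, f, _, _ => exact f.elim

theorem mkR_lt_iff {s t : SignType} {a b a' b' : ℝ} (h1 : 0 < a - b ↔ 0 < a' - b')
    (h2 : 0 < b - a ↔ 0 < b' - a') : mkR s a < mkR t b ↔ mkR s a' < mkR t b' := by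
  simp only [sub_pos] at h1 h2
  have := Real.exp_pos a
  have := Real.exp_pos b
  have := Real.exp_pos a'
  have := Real.exp_pos b'
  cases s <;> cases t <;> simp [mkR, *] <;> try (constructor <;> intro <;> linarith)

theorem term_lt_invariant {ι : Type} [Fintype ι] (t₁ t₂ : divLang.Term ι) {B : ℕ}
    (hB : t₁.listEncode.length + t₂.listEncode.length ≤ B) {w w' : ι → ℝ} (h : TypeEq B w w') :
    t₁.realize w < t₂.realize w ↔ t₁.realize w' < t₂.realize w' := by
  obtain ⟨c, g, hc, hg⟩ := term_spec t₁
  obtain ⟨c', g', hc', hg'⟩ := term_spec t₂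
  have e : (fun i => SignType.sign (w i)) = fun i => SignType.sign (w' i) := funext h.1
  simp only [hg, hg', e]
  have hB' : (t₁.listEncode.length + t₂.listEncode.length : ℤ) ≤ B := by exact_mod_cast hB
  have h1 := h.2 (fun i => c i - c' i) (fun i => by
    have := abs_sub (c i) (c' i)
    linarith [hc i, hc' i])
  have h2 := h.2 (fun i => c' i - c i) (fun i => by
    have := abs_sub (c' i) (c i)
    linarith [hc i, hc' i])
  simp only [Int.cast_sub, sub_mul, Finset.sum_sub_distrib] at h1 h2
  exact mkR_lt_iff h1 h2

theorem term_eq_invariant {ι : Type} [Fintype ι] (t₁ t₂ : divLang.Term ι) {B : ℕ}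
    (hB : t₁.listEncode.length + t₂.listEncode.length ≤ B) {w w' : ι → ℝ} (h : TypeEq B w w') :
    t₁.realize w = t₂.realize w ↔ t₁.realize w' = t₂.realize w' := by
  have h1 := term_lt_invariant t₁ t₂ hB h
  have h2 := term_lt_invariant t₂ t₁ (by omega) h
  rw [le_antisymm_iff, le_antisymm_iff, ← not_lt, ← not_lt, ← not_lt, ← not_lt, h1, h2]

/-! ### Formulas -/

def fsz {α : Type} : {n : ℕ} → divLang.BoundedFormula α n → ℕ
  | _, .falsum => 0
  | _, .equal t₁ t₂ => t₁.listEncode.length + t₂.listEncode.length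
  | _, .rel (l := l) _ ts => ∑ i : Fin l, (ts i).listEncode.length
  | _, .imp φ ψ => fsz φ + fsz ψ
  | _, .all φ => fsz φ + 1

/-- bounds on coefficients at level `n` -/
def bd (c n : ℕ) : ℕ := (c + 2) ^ (3 ^ (c - n))

theorem bd_pos (c n : ℕ) : 1 ≤ bd c n := Nat.one_le_pow _ _ (by omega)

theorem le_bd (c n : ℕ) : c + 2 ≤ bd c n := by
  unfold bd
  exact Nat.le_self_pow (by positivity) _

theorem bd_succ {c n : ℕ} (h : n + 1 ≤ c) : 2 * bd c (n + 1) ^ 2 ≤ bd c n := by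
  have e : c - n = (c - (n + 1)) + 1 := by omega
  have : bd c n = bd c (n + 1) ^ 3 := by
    unfold bd
    rw [e, pow_succ 3, pow_mul]
  rw [this, pow_succ _ 2, mul_comm]
  exact Nat.mul_le_mul_left _ (by have := le_bd c (n+1); omega)

theorem formula_invariant {α : Type} [Fintype α] {n : ℕ} (φ : divLang.BoundedFormula α n) (c : ℕ)
    (hc : n + fsz φ ≤ c) {v v' : α → ℝ} {x x' : Fin n → ℝ}
    (h : TypeEq (bd c n) (Sum.elim v x) (Sum.elim v' x')) : φ.Realize v x ↔ φ.Realize v' x' := by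
  induction φ generalizing v v' with
  | falsum => rfl
  | @equal n t₁ t₂ =>
    simp only [fsz] at hc
    exact term_eq_invariant t₁ t₂ (by have := le_bd c n; omega) h
  | @rel n l R ts =>
    match l, R, ts, hc with
    | 0, R, _, _ => exact R.elim
    | 1, R, _, _ => exact R.elim
    | 2, R, ts, hc =>
      simp only [fsz, Fin.sum_univ_two] at hc
      exact term_lt_invariant (ts 0) (ts 1) (by have := le_bd c n; omega) h
    | _ + 3, R, _, _ => exact R.elim
  | imp φ ψ ih1 ih2 =>
    simp only [fsz] at hc
    simp only [BoundedFormula.realize_imp]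
    rw [ih1 (by omega) h, ih2 (by omega) h]
  | @all n φ ih =>
    simp only [fsz] at hc
    simp only [BoundedFormula.realize_all]
    have hh := h.mono (bd_succ (c := c) (n := n) (by omega))
    have symm : TypeEq (2 * bd c (n + 1) ^ 2) (Sum.elim v' x') (Sum.elim v x) :=
      ⟨fun i => (hh.1 i).symm, fun c hc => (hh.2 c hc).symm⟩
    constructor
    · intro H a
      obtain ⟨b, hb⟩ := symm.extend (bd_pos _ _) a
      exact (ih (by omega) hb).2 (H b)
    · intro H a
      obtain ⟨b, hb⟩ := hh.extend (bd_pos _ _) a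
      exact (ih (by omega) hb).2 (H b)

end Paper

namespace Paper

open FirstOrder Language

/-! ### Quantifier-free definability -/

/-- The predicate `P` is defined by a quantifier-free formula. -/
def QFDef {α : Type} (P : (α → ℝ) → Prop) : Prop :=
  ∃ ψ : divLang.Formula α, ψ.IsQF ∧ ∀ v : α → ℝ, ψ.Realize v ↔ P v

namespace QFDef

variable {α : Type}

theorem congr {P Q : (α → ℝ) → Prop} (h : QFDef P) (e : ∀ v, P v ↔ Q v) : QFDef Q := by
  obtain ⟨ψ, h1, h2⟩ := h
  exact ⟨ψ, h1, fun v => (h2 v).trans (e v)⟩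

theorem false' : QFDef (fun _ : α → ℝ => False) :=
  ⟨⊥, BoundedFormula.isQF_bot, fun v => by simp [Formula.Realize]⟩

theorem true' : QFDef (fun _ : α → ℝ => True) :=
  ⟨⊤, BoundedFormula.IsQF.top, fun v => by simp [Formula.Realize]⟩

theorem const (p : Prop) : QFDef (fun _ : α → ℝ => p) := by
  by_cases hp : p
  · exact true'.congr fun v => by simp [hp]
  · exact false'.congr fun v => by simp [hp]

theorem and {P Q : (α → ℝ) → Prop} (h : QFDef P) (h' : QFDef Q) : QFDef fun v => P v ∧ Q v := by
  obtain ⟨ψ, h1, h2⟩ := h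
  obtain ⟨ψ', h1', h2'⟩ := h'
  refine ⟨ψ ⊓ ψ', h1.inf h1', fun v => ?_⟩
  change _ ↔ P v ∧ Q v
  rw [← h2, ← h2']
  simp [Formula.Realize]

theorem not {P : (α → ℝ) → Prop} (h : QFDef P) : QFDef fun v => ¬ P v := by
  obtain ⟨ψ, h1, h2⟩ := h
  refine ⟨ψ.not, h1.not, fun v => ?_⟩
  change _ ↔ ¬ P v
  rw [← h2]
  simp [Formula.Realize]

theorem or {P Q : (α → ℝ) → Prop} (h : QFDef P) (h' : QFDef Q) : QFDef fun v => P v ∨ Q v :=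
  (h.not.and h'.not).not.congr fun v => by tauto

theorem forall_finset {ι : Type*} (s : Finset ι) {P : ι → (α → ℝ) → Prop}
    (h : ∀ i, QFDef (P i)) : QFDef fun v => ∀ i ∈ s, P i v := by
  classical
  induction s using Finset.induction_on with
  | empty => exact true'.congr fun v => by simp
  | insert a s _ ih => exact ((h a).and ih).congr fun v => by simp

theorem all {ι : Type*} [Finite ι] {P : ι → (α → ℝ) → Prop}
    (h : ∀ i, QFDef (P i)) : QFDef fun v => ∀ i, P i v := by
  have := Fintype.ofFinite ι
  exact (forall_finset Finset.univ h).congr fun v => by simp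

theorem ex {ι : Type*} [Finite ι] {P : ι → (α → ℝ) → Prop}
    (h : ∀ i, QFDef (P i)) : QFDef fun v => ∃ i, P i v :=
  (all fun i => (h i).not).not.congr fun v => by simp

theorem lt (t₁ t₂ : divLang.Term α) : QFDef fun v => t₁.realize v < t₂.realize v := by
  refine ⟨BoundedFormula.rel (L := divLang) (l := 2) () ![t₁.relabel Sum.inl, t₂.relabel Sum.inl],
    (BoundedFormula.IsAtomic.rel _ _).isQF, fun v => ?_⟩
  unfold Formula.Realize
  erw [BoundedFormula.realize_rel, rel2]
  simp only [Matrix.cons_val_zero, Matrix.cons_val_one]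
  rw [Term.realize_relabel, Term.realize_relabel]
  rfl

theorem ltPred {f g : (α → ℝ) → ℝ} (hf : ∃ t : divLang.Term α, ∀ v, t.realize v = f v)
    (hg : ∃ t : divLang.Term α, ∀ v, t.realize v = g v) : QFDef fun v => f v < g v := by
  obtain ⟨t, ht⟩ := hf
  obtain ⟨t', ht'⟩ := hg
  exact (lt t t').congr fun v => by rw [ht, ht']

end QFDef

section
variable {α : Type}

theorem term_zero : ∃ t : divLang.Term α, ∀ v : α → ℝ, t.realize v = 0 :=
  ⟨.func (L := divLang) (l := 0) (0 : Fin 3) Fin.elim0, fun v => by simp⟩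

theorem term_one : ∃ t : divLang.Term α, ∀ v : α → ℝ, t.realize v = 1 :=
  ⟨.func (L := divLang) (l := 0) (1 : Fin 3) Fin.elim0, fun v => by simp⟩

theorem term_var (i : α) : ∃ t : divLang.Term α, ∀ v : α → ℝ, t.realize v = v i :=
  ⟨.var i, fun v => by simp⟩

theorem term_mul {f g : (α → ℝ) → ℝ} (hf : ∃ t : divLang.Term α, ∀ v, t.realize v = f v)
    (hg : ∃ t : divLang.Term α, ∀ v, t.realize v = g v) :
    ∃ t : divLang.Term α, ∀ v : α → ℝ, t.realize v = f v * g v := by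
  obtain ⟨t, ht⟩ := hf
  obtain ⟨t', ht'⟩ := hg
  exact ⟨.func (L := divLang) (l := 2) (0 : Fin 2) ![t, t'], fun v => by simp [ht, ht']⟩

theorem term_div {f g : (α → ℝ) → ℝ} (hf : ∃ t : divLang.Term α, ∀ v, t.realize v = f v)
    (hg : ∃ t : divLang.Term α, ∀ v, t.realize v = g v) :
    ∃ t : divLang.Term α, ∀ v : α → ℝ, t.realize v = f v / g v := by
  obtain ⟨t, ht⟩ := hf
  obtain ⟨t', ht'⟩ := hg
  exact ⟨.func (L := divLang) (l := 2) (1 : Fin 2) ![t, t'], fun v => by simp [ht, ht']⟩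

theorem term_pow (i : α) (n : ℕ) : ∃ t : divLang.Term α, ∀ v : α → ℝ, t.realize v = v i ^ n := by
  induction n with
  | zero => simpa using term_one
  | succ n ih => simpa [pow_succ] using term_mul ih (term_var i)

theorem term_zpow (i : α) (k : ℤ) : ∃ t : divLang.Term α, ∀ v : α → ℝ, t.realize v = v i ^ k := by
  obtain ⟨n, rfl | rfl⟩ := k.eq_nat_or_neg
  · simpa using term_pow i n
  · simpa using term_div term_one (term_pow i n)

theorem term_prod (s : Finset α) (c : α → ℤ) :
    ∃ t : divLang.Term α, ∀ v : α → ℝ, t.realize v = ∏ i ∈ s, v i ^ c i := by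
  classical
  induction s using Finset.induction_on with
  | empty => simpa using term_one
  | insert a s ha ih =>
    simp only [Finset.prod_insert ha]
    exact term_mul (term_zpow a _) ih

theorem qf_sign (i : α) (s : SignType) : QFDef fun v : α → ℝ => SignType.sign (v i) = s := by
  have h1 := QFDef.ltPred (term_var i) term_zero
  have h2 := QFDef.ltPred term_zero (term_var i)
  cases s
  · refine (h1.not.and h2.not).congr fun v => ?_
    simp only [not_lt]
    rw [← le_antisymm_iff, eq_comm]
    exact sign_eq_zero_iff.symm
  · exact h1.congr fun v => sign_eq_neg_one_iff.symm
  · exact h2.congr fun v => sign_eq_one_iff.symm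

theorem qf_lin [Fintype α] (c : α → ℤ) :
    QFDef fun v : α → ℝ => 0 < ∑ i, c i * Real.log (v i) := by
  classical
  have key : QFDef fun v : α → ℝ => ∃ Z : Finset α, (∀ i, (i ∈ Z ↔ SignType.sign (v i) = 0)) ∧
      1 < (∏ i ∈ Zᶜ, v i ^ c i) * (∏ i ∈ Zᶜ, v i ^ c i) := by
    refine QFDef.ex fun Z => QFDef.and (QFDef.all fun i => ?_)
      (QFDef.ltPred term_one (term_mul (term_prod _ _) (term_prod _ _)))
    by_cases hi : i ∈ Z
    · exact (qf_sign i 0).congr fun v => by simp [hi]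
    · exact (qf_sign i 0).not.congr fun v => by simp [hi]
  refine key.congr fun v => ?_
  have main : ∀ Z : Finset α, (∀ i, (i ∈ Z ↔ SignType.sign (v i) = 0)) →
      (1 < (∏ i ∈ Zᶜ, v i ^ c i) * (∏ i ∈ Zᶜ, v i ^ c i) ↔
        0 < ∑ i, c i * Real.log (v i)) := by
    intro Z hZ
    have hnz : ∀ i ∈ Zᶜ, v i ≠ 0 := fun i hi h0 => by
      rw [Finset.mem_compl, hZ] at hi
      exact hi (by simp [h0])
    have hnz' : ∀ i ∈ Zᶜ, v i ^ c i ≠ 0 := fun i hi => zpow_ne_zero _ (hnz i hi)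
    have hp : ∏ i ∈ Zᶜ, v i ^ c i ≠ 0 := Finset.prod_ne_zero_iff.2 hnz'
    have hsum : Real.log (∏ i ∈ Zᶜ, v i ^ c i) = ∑ i, c i * Real.log (v i) := by
      rw [Real.log_prod hnz', ← Finset.sum_compl_add_sum Z]
      have : ∑ i ∈ Z, (c i : ℝ) * Real.log (v i) = 0 := Finset.sum_eq_zero fun i hi => by
        have : v i = 0 := by simpa using (hZ i).1 hi
        simp [this]
      rw [this, add_zero]
      exact Finset.sum_congr rfl fun i _ => by rw [Real.log_zpow]
    rw [← hsum, ← Real.log_pos_iff (mul_self_nonneg _), Real.log_mul hp hp]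
    constructor <;> intro h <;> linarith
  constructor
  · rintro ⟨Z, hZ, h⟩
    exact (main Z hZ).1 h
  · intro h
    refine ⟨Finset.univ.filter fun i => SignType.sign (v i) = 0, by simp, ?_⟩
    exact (main _ (by simp)).2 h

theorem qf_of_invariant [Fintype α] (B : ℕ) (P : (α → ℝ) → Prop)
    (h : ∀ v v', TypeEq B v v' → (P v ↔ P v')) : QFDef P := by
  classical
  let C := α → Set.Icc (-(B : ℤ)) B
  let T := (α → SignType) × (C → Prop)
  have : Finite C := inferInstance
  have : Finite (C → Prop) := inferInstance
  let F : T → (α → ℝ) → Prop := fun t v => (∀ i, SignType.sign (v i) = t.1 i) ∧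
    ∀ c : C, ((0 < ∑ i, ((c i : ℤ) : ℝ) * Real.log (v i)) ↔ t.2 c)
  have hF : ∀ t, QFDef (F t) := fun t => (QFDef.all fun i => qf_sign i _).and
    (QFDef.all fun c => by
      by_cases hc : t.2 c
      · exact (qf_lin fun i => (c i : ℤ)).congr fun v => by simp [hc]
      · exact (qf_lin fun i => (c i : ℤ)).not.congr fun v => by simp [hc])
  have : QFDef fun v => ∃ t : T, F t v ∧ ∃ v', F t v' ∧ P v' :=
    QFDef.ex fun t => (hF t).and (QFDef.const _)
  refine this.congr fun v => ⟨?_, ?_⟩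
  · rintro ⟨t, h1, v', h2, hP⟩
    refine (h v v' ⟨fun i => (h1.1 i).trans (h2.1 i).symm, fun c hc => ?_⟩).2 hP
    exact (h1.2 fun i => ⟨c i, abs_le.1 (hc i)⟩).trans (h2.2 fun i => ⟨c i, abs_le.1 (hc i)⟩).symm
  · intro hP
    have hv : F ⟨fun i => SignType.sign (v i),
      fun c => 0 < ∑ i, ((c i : ℤ) : ℝ) * Real.log (v i)⟩ v := ⟨fun i => rfl, fun c => Iff.rfl⟩
    exact ⟨_, hv, v, hv, hP⟩

theorem qe_fintype [Fintype α] (φ : divLang.Formula α) : QFDef fun v : α → ℝ => φ.Realize v := by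
  refine qf_of_invariant (bd (fsz φ) 0) _ fun v v' h => ?_
  refine formula_invariant φ (fsz φ) (by omega) ⟨?_, ?_⟩
  · rintro (i | i)
    · exact h.1 i
    · exact i.elim0
  · intro c hc
    have := h.2 (fun i => c (Sum.inl i)) fun i => hc _
    simpa using this

theorem qe_all (φ : divLang.Formula α) : QFDef fun v : α → ℝ => φ.Realize v := by
  classical
  obtain ⟨ψ, h1, h2⟩ := qe_fintype (α := φ.freeVarFinset) (φ.restrictFreeVar id)
  refine ⟨ψ.relabel Subtype.val, h1.relabel _, fun v => ?_⟩
  rw [Formula.realize_relabel, h2]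
  exact BoundedFormula.realize_restrictFreeVar _ (by simp)

end

end Paper

namespace Paper

open FirstOrder Language

/-! ### The decision procedure -/

/-- Codes of real numbers: a sign (modulo 3) and an integer logarithm as a difference. -/
abbrev E := ℕ × ℕ × ℕ

def sg (s : ℕ) : SignType := if s % 3 = 0 then 0 else if s % 3 = 1 then 1 else -1

noncomputable def val (x : E) : ℝ := mkR (sg x.1) ((x.2.1 : ℝ) - x.2.2)

def mulE (x y : E) : E := (x.1 * y.1, x.2.1 + y.2.1, x.2.2 + y.2.2)

def divE (x y : E) : E := (x.1 * y.1, x.2.1 + y.2.2, x.2.2 + y.2.1)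

def ltE (x y : E) : Prop :=
  (x.1 % 3 = 1 ∧ y.1 % 3 = 1 ∧ x.2.1 + y.2.2 < y.2.1 + x.2.2) ∨ (x.1 % 3 = 0 ∧ y.1 % 3 = 1) ∨
    (x.1 % 3 = 2 ∧ (¬ y.1 % 3 = 2 ∨ y.2.1 + x.2.2 < x.2.1 + y.2.2))

instance : DecidableRel ltE := fun x y => by unfold ltE; infer_instance

theorem sg_mul (s t : ℕ) : sg (s * t) = sg s * sg t := by
  unfold sg
  rw [Nat.mul_mod]
  have h1 : s % 3 < 3 := Nat.mod_lt _ (by norm_num)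
  have h2 : t % 3 < 3 := Nat.mod_lt _ (by norm_num)
  generalize s % 3 = a at *
  generalize t % 3 = b at *
  interval_cases a <;> interval_cases b <;> decide

theorem val_mul (x y : E) : val (mulE x y) = val x * val y := by
  simp only [val, mulE, sg_mul, mkR, SignType.coe_mul]
  push_cast
  rw [show (x.2.1 : ℝ) + y.2.1 - (x.2.2 + y.2.2) = (x.2.1 - x.2.2) + (y.2.1 - y.2.2) by ring,
    Real.exp_add]
  ring

theorem val_div (x y : E) : val (divE x y) = val x / val y := by
  simp only [val, divE, sg_mul, mkR, SignType.coe_mul]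
  push_cast
  rw [show (x.2.1 : ℝ) + y.2.2 - (x.2.2 + y.2.1) = (x.2.1 - x.2.2) - (y.2.1 - y.2.2) by ring,
    Real.exp_sub]
  generalize sg y.1 = s'
  cases s' <;> simp [div_eq_mul_inv] <;> ring

theorem ltE_iff (x y : E) : ltE x y ↔ val x < val y := by
  obtain ⟨s, a, b⟩ := x
  obtain ⟨t, a', b'⟩ := y
  have h1 : s % 3 < 3 := Nat.mod_lt _ (by norm_num)
  have h2 : t % 3 < 3 := Nat.mod_lt _ (by norm_num)
  have e1 := Real.exp_pos ((a : ℝ) - b)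
  have e2 := Real.exp_pos ((a' : ℝ) - b')
  have k1 : a + b' < a' + b ↔ (a : ℝ) - b < a' - b' := by
    rw [sub_lt_iff_lt_add, sub_add_eq_add_sub, lt_sub_iff_add_lt]; exact_mod_cast Iff.rfl
  have k2 : a' + b < a + b' ↔ (a' : ℝ) - b' < a - b := by
    rw [sub_lt_iff_lt_add, sub_add_eq_add_sub, lt_sub_iff_add_lt]; exact_mod_cast Iff.rfl
  simp only [ltE, val, sg, mkR, k1, k2]
  generalize s % 3 = p at *
  generalize t % 3 = q at *
  interval_cases p <;> interval_cases q <;> simp [*] <;> linarith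

def stepT (e : List E) (tok : ℕ) (st : List E) : List E :=
  if tok % 2 = 0 then e.getD (tok / 2 / 2) (0, 0, 0) :: st
  else if (tok / 2).unpair.1 = 0 then ((tok / 2).unpair.2, 0, 0) :: st
  else (if (tok / 2).unpair.2 = 0 then mulE (st.getD 0 (0, 0, 0)) (st.getD 1 (0, 0, 0))
    else divE (st.getD 0 (0, 0, 0)) (st.getD 1 (0, 0, 0))) :: st.tail.tail

def toList (n : ℕ) : List ℕ := (Encodable.decode n : Option (List ℕ)).getD []

def termVal (tok : ℕ) (e : List E) : E :=
  ((toList (tok / 2).unpair.2).foldr (stepT e) []).getD 0 (0, 0, 0)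

def scale (K : ℕ) (x : E) : E := (x.1, K * x.2.1, K * x.2.2)

def wt (e : List E) : ℕ := e.foldr (fun x s => x.2.1 + x.2.2 + s) 0

def fact (n : ℕ) : ℕ := Nat.rec 1 (fun k r => (k + 1) * r) n

theorem fact_eq (n : ℕ) : fact n = n.factorial := by
  induction n with
  | zero => rfl
  | succ n ih => rw [Nat.factorial_succ, ← ih]; rfl

def ext (c : ℕ) (e : List E) : List (List E) :=
  (List.range 3).flatMap fun s =>
    (List.range (2 * fact (bd c (e.length + 1)) * bd c (e.length + 1) * wt e + 2)).flatMap fun a =>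
      (List.range (2 * fact (bd c (e.length + 1)) * bd c (e.length + 1) * wt e + 2)).map fun b =>
        e.map (scale (2 * fact (bd c (e.length + 1)))) ++ [(s, a, b)]

def envs (c n : ℕ) : List (List E) := Nat.rec [List.nil] (fun _ r => r.flatMap (ext c)) n

abbrev Item := ℕ × List (List E)

def eqItem (c t₁ t₂ : ℕ) : Item :=
  ((t₁ / 2).unpair.1, (envs c (t₁ / 2).unpair.1).filter fun e =>
    ¬ ltE (termVal t₁ e) (termVal t₂ e) ∧ ¬ ltE (termVal t₂ e) (termVal t₁ e))

def ltItem (c t₁ t₂ : ℕ) : Item :=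
  ((t₁ / 2).unpair.1, (envs c (t₁ / 2).unpair.1).filter fun e =>
    ltE (termVal t₁ e) (termVal t₂ e))

def impItem (c : ℕ) (A B : Item) : Item :=
  (A.1, (envs c A.1).filter fun e => ¬ (∃ e' ∈ A.2, e' = e) ∨ ∃ e' ∈ B.2, e' = e)

def allItem (c : ℕ) (A : Item) : Item :=
  (A.1 - 1, (envs c (A.1 - 1)).filter fun e => ∀ e' ∈ ext c e, ∃ u ∈ A.2, u = e')

def stepF (c t : ℕ) (l : List ℕ) (H : List (List Item)) : List Item :=
  if t % 2 = 0 then eqItem c t (l.getD 0 0) :: H.getD 1 []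
  else if t / 2 % 2 = 0 then ltItem c (l.getD 1 0) (l.getD 2 0) :: H.getD 3 []
  else if t / 2 / 2 = 0 then
    impItem c ((H.getD 0 []).getD 0 (0, [])) ((H.getD 0 []).getD 1 (0, [])) ::
      (H.getD 0 []).tail.tail
  else if t / 2 / 2 = 1 then
    allItem c ((H.getD 0 []).getD 0 (0, [])) :: (H.getD 0 []).tail
  else (t / 2 / 2 - 2, []) :: H.getD 0 []

def hist (c : ℕ) (l : List ℕ) : List (List Item) :=
  List.rec [List.nil] (fun t l H => stepF c t l H :: H) l

def stackOf (c : ℕ) (l : List ℕ) : List Item := (hist c l).getD 0 []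

def decis (c : ℕ) : Bool :=
  decide (∃ e ∈ ((stackOf c (toList c)).getD 0 (0, [])).2, e = [])

/-! #### Correctness: terms -/

noncomputable def xs (n : ℕ) (e : List E) : Fin n → ℝ := fun i => val (e.getD i (0, 0, 0))

theorem encode_list {X : Type*} [Encodable X] (l : List X) :
    Encodable.encode l = Encodable.encode (l.map Encodable.encode) := by
  induction l with
  | nil => rfl
  | cons a l ih => simp [Encodable.encode_list_cons, ih]

theorem toList_encode {X : Type*} [Encodable X] (l : List X) :
    toList (Encodable.encode l) = l.map Encodable.encode := by
  rw [encode_list, toList, Encodable.encodek]; rfl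

theorem evalT_spec {n : ℕ} (t : divLang.Term (Empty ⊕ Fin n)) (e : List E) (st : List E) :
    ∃ x : E, ((t.listEncode.map Encodable.encode).foldr (stepT e) st) = x :: st ∧
      val x = t.realize (Sum.elim default (xs n e)) := by
  induction t generalizing st with
  | var i =>
    rcases i with i | i
    · exact i.elim
    refine ⟨e.getD i (0, 0, 0), ?_, ?_⟩
    · simp [Term.listEncode, stepT, Encodable.encode_inl, Encodable.encode_inr]
      have hi : Encodable.encode i = i.val := rfl
      rw [hi]
      congr 2
      omega
    · rfl
  | @func l f ts ih =>
    match l, f, ts, ih with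
    | 0, f, ts, ih =>
      have hf : Encodable.encode (f : divLang.Functions 0) = (f : Fin 3).val := rfl
      refine ⟨(Fin.val (n := 3) f, 0, 0), ?_, ?_⟩
      · simp [Term.listEncode, stepT, Encodable.encode_inr, Encodable.encode_sigma_val, hf]
        rw [show (2 * Nat.pair 0 (Fin.val (n := 3) f) + 1) / 2 = Nat.pair 0 (Fin.val (n := 3) f) by
          omega, Nat.unpair_pair]
        simp
      · simp only [Term.realize_func, fun0, val]
        clear hf
        change Fin 3 at f
        fin_cases f <;> simp [sg, mkR]
    | 1, f, ts, ih => exact f.elim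
    | 2, f, ts, ih =>
      have hf : Encodable.encode (f : divLang.Functions 2) = (f : Fin 2).val := rfl
      obtain ⟨y, hy, hy'⟩ := ih 1 st
      obtain ⟨x, hx, hx'⟩ := ih 0 (y :: st)
      refine ⟨if f = 0 then mulE x y else divE x y, ?_, ?_⟩
      · simp [Term.listEncode, List.finRange_succ, hy, hx]
        rw [hf, stepT, if_neg (by omega),
          show (2 * Nat.pair 2 (Fin.val (n := 2) f) + 1) / 2 = Nat.pair 2 (Fin.val (n := 2) f) by
          omega, Nat.unpair_pair]
        change Fin 2 at f
        fin_cases f <;> simp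
      · simp only [Term.realize_func, fun2, ← hx', ← hy']
        split_ifs
        · exact val_mul _ _
        · exact val_div _ _
    | _ + 3, f, _, _ => exact f.elim

theorem termVal_spec {n : ℕ} (t : divLang.Term (Empty ⊕ Fin n)) (e : List E) :
    val (termVal (Encodable.encode (Sum.inl ⟨n, t⟩ : (Σ k, divLang.Term (Empty ⊕ Fin k)) ⊕
      ((Σ n, divLang.Relations n) ⊕ ℕ))) e) = t.realize (Sum.elim default (xs n e)) := by
  obtain ⟨x, hx, hx'⟩ := evalT_spec t e []
  have : toList (Encodable.encode t) = t.listEncode.map Encodable.encode :=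
    toList_encode t.listEncode
  rw [termVal, Encodable.encode_inl, Nat.mul_div_cancel_left _ (by norm_num),
    Encodable.encode_sigma_val, Nat.unpair_pair, this, hx]
  exact hx'

end Paper

namespace Paper

open FirstOrder Language

/-! #### Correctness: the grid -/

/-- integer logarithm of a code -/
def zlog (x : E) : ℤ := if sg x.1 = 0 then 0 else (x.2.1 : ℤ) - x.2.2

theorem log_val (x : E) : Real.log (val x) = zlog x := by
  unfold val zlog
  split_ifs with h
  · simp [h, mkR]
  · rw [log_mkR h]; push_cast; rfl

theorem sign_val (x : E) : SignType.sign (val x) = sg x.1 := sign_mkR _ _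

theorem zlog_scale (K : ℕ) (x : E) : zlog (scale K x) = K * zlog x := by
  unfold zlog scale
  dsimp only
  split_ifs
  · simp
  · push_cast; ring

theorem abs_zlog (x : E) : |zlog x| ≤ (x.2.1 + x.2.2 : ℕ) := by
  unfold zlog
  split_ifs
  · simp only [abs_zero]; positivity
  · rw [abs_le]; push_cast; constructor <;> omega

theorem wt_eq (e : List E) : wt e = ∑ i : Fin e.length, (e[i].2.1 + e[i].2.2) := by
  induction e with
  | nil => rfl
  | cons a l ih =>
    rw [show wt (a :: l) = a.2.1 + a.2.2 + wt l from rfl, ih]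
    simp [Fin.sum_univ_succ]

theorem mem_ext {c : ℕ} {e e' : List E} : e' ∈ ext c e ↔ ∃ s < 3,
    ∃ a < 2 * fact (bd c (e.length + 1)) * bd c (e.length + 1) * wt e + 2,
    ∃ b < 2 * fact (bd c (e.length + 1)) * bd c (e.length + 1) * wt e + 2,
      e' = e.map (scale (2 * fact (bd c (e.length + 1)))) ++ [(s, a, b)] := by
  simp only [ext, List.mem_flatMap, List.mem_map, List.mem_range, eq_comm]

theorem envs_length {c n : ℕ} {e : List E} (h : e ∈ envs c n) : e.length = n := by
  induction n generalizing e with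
  | zero => simp [envs] at h; simp [h]
  | succ n ih =>
    change e ∈ (envs c n).flatMap (ext c) at h
    obtain ⟨e', he', h⟩ := List.mem_flatMap.1 h
    obtain ⟨s, -, a, -, b, -, rfl⟩ := mem_ext.1 h
    simp [ih he']

theorem mem_envs_succ {c n : ℕ} {e e' : List E} (h : e ∈ envs c n) (h' : e' ∈ ext c e) :
    e' ∈ envs c (n + 1) := by
  change e' ∈ (envs c n).flatMap (ext c)
  exact List.mem_flatMap.2 ⟨e, h, h'⟩

theorem xs_concat (e : List E) (u : E) :
    xs (e.length + 1) (e ++ [u]) = (Fin.snoc (xs e.length e) (val u) : Fin (e.length + 1) → ℝ) := by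
  ext i
  refine Fin.lastCases ?_ (fun i => ?_) i
  · simp [xs]
  · simp [xs]

theorem xs_concat' {n : ℕ} (e : List E) (h : e.length = n) (u : E) :
    xs (n + 1) (e ++ [u]) = (Fin.snoc (xs n e) (val u) : Fin (n + 1) → ℝ) := by
  subst h
  exact xs_concat e u

theorem xs_map (K : ℕ) (e : List E) (i : Fin e.length) :
    xs e.length (e.map (scale K)) i = val (scale K e[i]) := by
  simp [xs]

theorem xs_self (e : List E) (i : Fin e.length) :
    xs e.length e i = val e[i] := by
  simp [xs]

def zvec (e : List E) : Empty ⊕ Fin e.length → ℤ := Sum.elim (fun i => i.elim) fun i => zlog e[i]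

theorem log_xs (e : List E) (i : Empty ⊕ Fin e.length) :
    Real.log (Sum.elim (default : Empty → ℝ) (xs e.length e) i) = zvec e i := by
  rcases i with i | i
  · exact i.elim
  · simp only [Sum.elim_inr, xs_self, zvec, log_val]

theorem log_xs_map (K : ℕ) (e : List E) (i : Empty ⊕ Fin e.length) :
    Real.log (Sum.elim (default : Empty → ℝ) (xs e.length (e.map (scale K))) i) = K * zvec e i := by
  rcases i with i | i
  · exact i.elim
  · simp only [Sum.elim_inr, xs_map, zvec, log_val, zlog_scale]; push_cast; rfl

theorem sum_zvec (e : List E) : ∑ i, |zvec e i| ≤ wt e := by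
  rw [wt_eq, Fintype.sum_sum_type]
  simp only [Finset.univ_eq_empty, Finset.sum_empty, zero_add]
  push_cast
  refine Finset.sum_le_sum fun i _ => ?_
  exact_mod_cast abs_zlog e[i]

theorem scale_typeEq (B : ℕ) {K : ℕ} (hK : 0 < K) (e : List E) :
    TypeEq B (Sum.elim (default : Empty → ℝ) (xs e.length e))
      (Sum.elim (default : Empty → ℝ) (xs e.length (e.map (scale K)))) := by
  constructor
  · rintro (i | i)
    · exact i.elim
    · simp only [Sum.elim_inr, xs_map, xs_self, sign_val, scale]
  · intro c _
    simp only [log_xs, log_xs_map]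
    have : ∑ i, (c i : ℝ) * ((K : ℝ) * (zvec e i : ℝ)) = K * ∑ i, (c i : ℝ) * (zvec e i : ℝ) := by
      rw [Finset.mul_sum]
      exact Finset.sum_congr rfl fun i _ => by ring
    rw [this]
    have hK' : (0 : ℝ) < K := by exact_mod_cast hK
    exact (mul_pos_iff_of_pos_left hK').symm

theorem fact_pos (n : ℕ) : 0 < fact n := by rw [fact_eq]; exact Nat.factorial_pos n

theorem grid {c : ℕ} (e : List E) (a : ℝ) : ∃ e' ∈ ext c e,
    TypeEq (bd c (e.length + 1))
      (Sum.elim (default : Empty → ℝ) (Fin.snoc (xs e.length e) a : Fin (e.length + 1) → ℝ))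
      (Sum.elim (default : Empty → ℝ) (xs (e.length + 1) e')) := by
  set B := bd c (e.length + 1) with hB
  have hB1 : 1 ≤ B := bd_pos _ _
  set K := 2 * fact B with hK
  have hKpos : 0 < K := by have := fact_pos B; omega
  have hT := scale_typeEq (2 * B ^ 2) hKpos e
  have hx : ∀ u : E, xs (e.length + 1) (e.map (scale K) ++ [u]) =
      (Fin.snoc (xs e.length (e.map (scale K))) (val u) : Fin (e.length + 1) → ℝ) := by
    intro u
    exact xs_concat' _ (List.length_map _) u
  by_cases ha : a = 0
  · refine ⟨e.map (scale K) ++ [(0, 0, 0)], mem_ext.2 ⟨0, by omega, 0, by omega, 0, by omega, rfl⟩,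
      ?_⟩
    rw [hx]
    refine TypeEq.snoc hT.1 ?_ ?_
    · rw [sign_val, ha]; simp [sg]
    · intro c d hc hd
      subst ha
      have : zlog (0, 0, 0) = 0 := by simp [zlog]
      simp only [log_val, this]
      simpa using hT.2 c fun i => (hc i).trans (by
        have : B ≤ 2 * B ^ 2 := by nlinarith
        exact_mod_cast this)
  · obtain ⟨b, hb, hΘ⟩ := hT.2.extend hB1 (Real.log a)
    have hM := hΘ {r | ∃ m : ℤ, r = ((2 * m : ℤ) : ℝ) ∧ |2 * m| ≤ ((K * B * wt e : ℕ) : ℤ)} (by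
      intro c d hc hd1 hd2
      obtain ⟨q, hq⟩ : d ∣ fact B := by rw [fact_eq]; exact Nat.dvd_factorial hd1 hd2
      have hqle : q ≤ fact B := by rw [hq]; exact Nat.le_mul_of_pos_left _ hd1
      refine ⟨q * ∑ i, c i * zvec e i, ?_, ?_⟩
      · simp only [log_xs_map]
        have hd0 : (d : ℝ) ≠ 0 := by positivity
        rw [div_eq_iff hd0, hK, hq]
        push_cast
        rw [Finset.mul_sum, Finset.mul_sum, Finset.sum_mul]
        exact Finset.sum_congr rfl fun i _ => by ring
      · have h1 : |∑ i, c i * zvec e i| ≤ B * wt e := by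
          calc |∑ i, c i * zvec e i| ≤ ∑ i, |c i * zvec e i| := Finset.abs_sum_le_sum_abs _ _
            _ ≤ ∑ i, (B : ℤ) * |zvec e i| := Finset.sum_le_sum fun i _ => by
                rw [abs_mul]; exact mul_le_mul_of_nonneg_right (hc i) (abs_nonneg _)
            _ = B * ∑ i, |zvec e i| := by rw [Finset.mul_sum]
            _ ≤ _ := mul_le_mul_of_nonneg_left (sum_zvec e) (by positivity)
        rw [abs_mul, abs_mul, Nat.abs_cast, abs_two, hK]
        push_cast
        have hqle' : (q : ℤ) ≤ fact B := by exact_mod_cast hqle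
        have : (q : ℤ) * |∑ i, c i * zvec e i| ≤ fact B * (B * wt e) :=
          mul_le_mul hqle' h1 (abs_nonneg _) (by positivity)
        linarith)
    obtain ⟨m, hm, hmb⟩ : ∃ m : ℤ, b = m ∧ |m| ≤ ((K * B * wt e : ℕ) : ℤ) + 1 := by
      rcases hM with ⟨s, ⟨p, rfl, hp⟩, t, ⟨q, rfl, hq⟩, rfl⟩ | ⟨s, ⟨p, rfl, hp⟩, rfl | rfl⟩
      · refine ⟨p + q, by push_cast; ring, ?_⟩
        rw [abs_le] at *
        constructor <;> omega
      · refine ⟨2 * p + 1, by push_cast; ring, ?_⟩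
        rw [abs_le] at *
        constructor <;> omega
      · refine ⟨2 * p - 1, by push_cast; ring, ?_⟩
        rw [abs_le] at *
        constructor <;> omega
    obtain ⟨s, hs, hsa⟩ : ∃ s < 3, sg s = SignType.sign a := by
      rcases lt_or_gt_of_ne ha with h | h
      · exact ⟨2, by omega, by rw [sign_neg h]; rfl⟩
      · exact ⟨1, by omega, by rw [sign_pos h]; rfl⟩
    rw [abs_le] at hmb
    refine ⟨e.map (scale K) ++ [(s, m.toNat, (-m).toNat)], mem_ext.2 ⟨s, hs, m.toNat, ?_,
      (-m).toNat, ?_, rfl⟩, ?_⟩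
    · rw [← hB, ← hK]; omega
    · rw [← hB, ← hK]; omega
    · rw [hx]
      have hz : zlog (s, m.toNat, (-m).toNat) = m := by
        unfold zlog
        rw [if_neg (by rw [hsa]; simpa using ha)]
        dsimp only
        omega
      refine TypeEq.snoc hT.1 ?_ ?_
      · rw [sign_val, hsa]
      · rw [log_val, hz, ← hm]
        exact hb

/-! #### Correctness: formulas -/

def toks {n : ℕ} (φ : divLang.BoundedFormula Empty n) : List ℕ :=
  φ.listEncode.map Encodable.encode

theorem stackOf_cons (c t : ℕ) (l : List ℕ) : stackOf c (t :: l) = stepF c t l (hist c l) := rfl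

theorem hist_zero (c : ℕ) (l : List ℕ) : (hist c l).getD 0 [] = stackOf c l := rfl

theorem hist_succ (c t k : ℕ) (l : List ℕ) :
    (hist c (t :: l)).getD (k + 1) [] = (hist c l).getD k [] := by
  change (stepF c t l (hist c l) :: hist c l).getD (k + 1) [] = _
  simp

abbrev Tok := (Σ k, divLang.Term (Empty ⊕ Fin k)) ⊕ ((Σ n, divLang.Relations n) ⊕ ℕ)

theorem unpair_term {n : ℕ} (t : divLang.Term (Empty ⊕ Fin n)) :
    (Encodable.encode (Sum.inl ⟨n, t⟩ : Tok) / 2).unpair.1 = n := by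
  rw [Encodable.encode_inl, Nat.mul_div_cancel_left _ (by norm_num),
    Encodable.encode_sigma_val, Nat.unpair_pair]
  rfl

theorem formula_spec {n : ℕ} (φ : divLang.BoundedFormula Empty n) (c : ℕ)
    (hc : n + fsz φ ≤ c) (l : List ℕ) :
    ∃ T, stackOf c (toks φ ++ l) = (n, T) :: stackOf c l ∧
      ∀ e ∈ envs c n, (e ∈ T ↔ φ.Realize default (xs n e)) := by
  induction φ generalizing l with
  | @falsum n =>
    refine ⟨[], ?_, ?_⟩
    · simp only [toks, BoundedFormula.listEncode, List.map_cons, List.map_nil, List.cons_append,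
        List.nil_append, stackOf_cons, Encodable.encode_inr, Encodable.encode_nat]
      rw [stepF, if_neg (by omega), if_neg (by omega), if_neg (by omega), if_neg (by omega),
        hist_zero]
      congr 2
      omega
    · intro e _
      simp only [List.not_mem_nil, false_iff]
      exact id
  | @equal n t₁ t₂ =>
    refine ⟨(eqItem c (Encodable.encode (Sum.inl ⟨n, t₁⟩ : Tok))
      (Encodable.encode (Sum.inl ⟨n, t₂⟩ : Tok))).2, ?_, ?_⟩
    · simp only [toks, BoundedFormula.listEncode, List.map_cons, List.map_nil, List.cons_append,
        List.nil_append, stackOf_cons]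
      rw [stepF, if_pos (by rw [Encodable.encode_inl]; omega), hist_succ, hist_zero]
      congr 1
      refine Prod.ext ?_ rfl
      exact unpair_term t₁
    · intro e he
      have hk := unpair_term t₁
      have v1 := termVal_spec t₁ e
      have v2 := termVal_spec t₂ e
      change (Encodable.encode (Sum.inl ⟨n, t₁⟩ : Tok) / 2).unpair.1 = n at hk
      change val (termVal (Encodable.encode (Sum.inl ⟨n, t₁⟩ : Tok)) e) = _ at v1
      change val (termVal (Encodable.encode (Sum.inl ⟨n, t₂⟩ : Tok)) e) = _ at v2
      generalize Encodable.encode (Sum.inl ⟨n, t₁⟩ : Tok) = k₁ at *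
      generalize Encodable.encode (Sum.inl ⟨n, t₂⟩ : Tok) = k₂ at *
      simp only [eqItem, hk, List.mem_filter, he, true_and, decide_eq_true_eq, ltE_iff, v1, v2,
        not_lt]
      exact and_comm.trans le_antisymm_iff.symm
  | @rel n k R ts =>
    match k, R, ts, hc with
    | 0, R, _, _ => exact R.elim
    | 1, R, _, _ => exact R.elim
    | 2, R, ts, hc =>
      refine ⟨(ltItem c (Encodable.encode (Sum.inl ⟨n, ts 0⟩ : Tok))
        (Encodable.encode (Sum.inl ⟨n, ts 1⟩ : Tok))).2, ?_, ?_⟩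
      · simp only [toks, BoundedFormula.listEncode, List.map_cons, List.map_nil, List.cons_append,
          List.nil_append, stackOf_cons, List.finRange_succ, List.finRange_zero]
        rw [stepF, if_neg (by rw [Encodable.encode_inr]; omega),
          if_pos (by rw [Encodable.encode_inr, Encodable.encode_inl]; omega),
          hist_succ, hist_succ, hist_succ, hist_zero]
        congr 1
        refine Prod.ext ?_ rfl
        exact unpair_term (ts 0)
      · intro e he
        have hk := unpair_term (ts 0)
        have v1 := termVal_spec (ts 0) e
        have v2 := termVal_spec (ts 1) e
        change (Encodable.encode (Sum.inl ⟨n, ts 0⟩ : Tok) / 2).unpair.1 = n at hk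
        change val (termVal (Encodable.encode (Sum.inl ⟨n, ts 0⟩ : Tok)) e) = _ at v1
        change val (termVal (Encodable.encode (Sum.inl ⟨n, ts 1⟩ : Tok)) e) = _ at v2
        generalize Encodable.encode (Sum.inl ⟨n, ts 0⟩ : Tok) = k₁ at *
        generalize Encodable.encode (Sum.inl ⟨n, ts 1⟩ : Tok) = k₂ at *
        simp only [ltItem, hk, List.mem_filter, he, true_and, decide_eq_true_eq, ltE_iff, v1, v2]
        exact Iff.rfl
    | _ + 3, R, _, _ => exact R.elim
  | @imp n φ ψ ih1 ih2 =>
    simp only [fsz] at hc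
    obtain ⟨T2, h2, h2'⟩ := ih2 (by omega) l
    obtain ⟨T1, h1, h1'⟩ := ih1 (by omega) (toks ψ ++ l)
    refine ⟨(impItem c (n, T1) (n, T2)).2, ?_, ?_⟩
    · have : toks (φ.imp ψ) ++ l = Encodable.encode (Sum.inr (Sum.inr 0) : Tok) ::
          (toks φ ++ (toks ψ ++ l)) := by
        simp [toks, BoundedFormula.listEncode]
      rw [this, stackOf_cons]
      simp only [Encodable.encode_inr, Encodable.encode_nat]
      rw [stepF, if_neg (by omega), if_neg (by omega), if_pos (by omega), hist_zero, h1, h2]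
      rfl
    · intro e he
      simp only [impItem, List.mem_filter, he, true_and, decide_eq_true_eq, exists_eq_right,
        h1' e he, h2' e he, BoundedFormula.realize_imp]
      tauto
  | @all n φ ih =>
    simp only [fsz] at hc
    obtain ⟨T, h, h'⟩ := ih (by omega) l
    refine ⟨(allItem c (n + 1, T)).2, ?_, ?_⟩
    · have : toks φ.all ++ l = Encodable.encode (Sum.inr (Sum.inr 1) : Tok) :: (toks φ ++ l) := by
        simp [toks, BoundedFormula.listEncode]
      rw [this, stackOf_cons]
      simp only [Encodable.encode_inr, Encodable.encode_nat]
      rw [stepF, if_neg (by omega), if_neg (by omega), if_neg (by omega), if_pos (by omega),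
        hist_zero, h]
      rfl
    · intro e he
      simp only [allItem, List.mem_filter, Nat.add_sub_cancel, he, true_and, decide_eq_true_eq,
        exists_eq_right]
      have hlen := envs_length he
      subst hlen
      have key : ∀ e' ∈ ext c e, (e' ∈ T ↔ φ.Realize default (xs (e.length + 1) e')) :=
        fun e' he' => h' e' (mem_envs_succ he he')
      constructor
      · intro H
        rw [BoundedFormula.realize_all]
        intro a
        obtain ⟨e', he', ht⟩ := grid (c := c) e a
        exact (formula_invariant φ c (by omega) ht).2 ((key e' he').1 (H e' he'))
      · intro H e' he'
        rw [key e' he']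
        obtain ⟨s, -, a, -, b, -, rfl⟩ := mem_ext.1 he'
        rw [xs_concat' _ (List.length_map _)]
        have hinv := formula_invariant φ.all c (by simp only [fsz]; omega)
          (scale_typeEq (bd c e.length) (K := 2 * fact (bd c (e.length + 1)))
            (by have := fact_pos (bd c (e.length + 1)); omega) e)
        exact (BoundedFormula.realize_all.1 (hinv.1 H)) _

/-! #### The size bound -/

theorem sum_le_encode (l : List ℕ) : (l.map (· + 1)).sum ≤ Encodable.encode l := by
  induction l with
  | nil => simp
  | cons a l ih =>
    rw [Encodable.encode_list_cons]
    have := Nat.add_le_pair (Encodable.encode a) (Encodable.encode l)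
    simp only [List.map_cons, List.sum_cons, Encodable.encode_nat] at *
    omega

theorem length_le_encode {X : Type*} [Encodable X] (l : List X) :
    l.length ≤ Encodable.encode l := by
  induction l with
  | nil => simp
  | cons a l ih =>
    rw [Encodable.encode_list_cons]
    have := Nat.add_le_pair (Encodable.encode a) (Encodable.encode l)
    simp only [List.length_cons]
    omega

theorem length_le_tok {n : ℕ} (t : divLang.Term (Empty ⊕ Fin n)) :
    t.listEncode.length ≤ Encodable.encode (Sum.inl ⟨n, t⟩ : Tok) := by
  rw [Encodable.encode_inl, Encodable.encode_sigma_val]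
  have h1 : Encodable.encode t = Encodable.encode t.listEncode := rfl
  have h2 := length_le_encode t.listEncode
  have h3 := Nat.right_le_pair (Encodable.encode n) (Encodable.encode t)
  dsimp only
  omega

theorem fsz_le {n : ℕ} (φ : divLang.BoundedFormula Empty n) :
    fsz φ ≤ ((toks φ).map (· + 1)).sum := by
  induction φ with
  | falsum => simp [fsz]
  | @equal n t₁ t₂ =>
    have h1 := length_le_tok t₁
    have h2 := length_le_tok t₂
    simp only [toks, BoundedFormula.listEncode, List.map_cons, List.map_nil, List.sum_cons,
      List.sum_nil, fsz]
    omega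
  | @rel n k R ts =>
    match k, R, ts with
    | 0, R, _ => exact R.elim
    | 1, R, _ => exact R.elim
    | 2, R, ts =>
      have h1 := length_le_tok (ts 0)
      have h2 := length_le_tok (ts 1)
      have e1 : (0 : Fin 1).succ = 1 := rfl
      simp only [toks, BoundedFormula.listEncode, List.map_cons, List.map_nil, List.sum_cons,
        List.sum_nil, fsz, Fin.sum_univ_two, List.finRange_succ, List.finRange_zero,
        List.cons_append, List.nil_append, e1]
      omega
    | _ + 3, R, _ => exact R.elim
  | imp φ ψ ih1 ih2 =>
    simp only [toks, BoundedFormula.listEncode, List.map_cons, List.map_append, List.sum_cons,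
      List.cons_append, List.sum_append, fsz] at *
    omega
  | all φ ih =>
    simp only [toks, BoundedFormula.listEncode, List.map_cons, List.sum_cons, fsz] at *
    omega

theorem decis_spec (φ : divLang.Sentence) :
    φ ∈ divLang.completeTheory ℝ ↔ decis (Encodable.encode φ) = true := by
  have henc : Encodable.encode φ = Encodable.encode (BoundedFormula.listEncode φ) := rfl
  have hto : toList (Encodable.encode φ) = toks φ := by
    rw [henc, toList_encode]; rfl
  have hsz : fsz φ ≤ Encodable.encode φ := by
    refine (fsz_le φ).trans ((sum_le_encode _).trans ?_)
    rw [henc]; exact (encode_list (BoundedFormula.listEncode φ)).symm.le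
  obtain ⟨T, h, h'⟩ := formula_spec φ (Encodable.encode φ) (by omega) []
  rw [List.append_nil] at h
  have := h' [] (by simp [envs])
  rw [decis, hto, h, decide_eq_true_eq]
  simp only [List.getD_cons_zero, exists_eq_right]
  rw [this, mem_completeTheory, Sentence.Realize, Formula.Realize]
  have e : xs 0 [] = (default : Fin 0 → ℝ) := Subsingleton.elim _ _
  rw [e]
  exact iff_of_eq (congrArg₂ _ (Subsingleton.elim _ _) (Subsingleton.elim _ _))

end Paper

namespace Paper

open FirstOrder Language

/-! ### The decision procedure is primitive recursive -/

section PrimrecSection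

variable {A B : Type} [Primcodable A] [Primcodable B]

theorem pr_filter {f : A → List B} {R : A → B → Prop} [∀ a b, Decidable (R a b)]
    (hf : Primrec f) (hR : PrimrecPred fun p : A × B => R p.1 p.2) :
    Primrec fun a => (f a).filter fun b => R a b := by
  have h : PrimrecRel fun (b : B) (a : A) => R a b :=
    hR.comp (Primrec.pair Primrec.snd Primrec.fst)
  exact (PrimrecRel.listFilter h).comp hf Primrec.id

theorem pr_exists_eq {f : A → List B} {g : A → B} (hf : Primrec f) (hg : Primrec g) :
    PrimrecPred fun a => ∃ b ∈ f a, b = g a :=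
  (PrimrecRel.exists_mem_list (Primrec.eq (α := B))).comp hf hg

theorem pr_forall {f : A → List B} {R : A → B → Prop} (hf : Primrec f)
    (hR : PrimrecPred fun p : A × B => R p.1 p.2) : PrimrecPred fun a => ∀ b ∈ f a, R a b := by
  have h : PrimrecRel fun (b : B) (a : A) => R a b :=
    hR.comp (Primrec.pair Primrec.snd Primrec.fst)
  exact (PrimrecRel.forall_mem_list h).comp hf Primrec.id

theorem pr_pow {f g : A → ℕ} (hf : Primrec f) (hg : Primrec g) : Primrec fun a => f a ^ g a :=
  (Primrec₂.unpaired'.1 Nat.Primrec.pow).comp hf hg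

theorem pr_add {f g : A → ℕ} (hf : Primrec f) (hg : Primrec g) : Primrec fun a => f a + g a :=
  Primrec.nat_add.comp hf hg

theorem pr_sub {f g : A → ℕ} (hf : Primrec f) (hg : Primrec g) : Primrec fun a => f a - g a :=
  Primrec.nat_sub.comp hf hg

theorem pr_mul {f g : A → ℕ} (hf : Primrec f) (hg : Primrec g) : Primrec fun a => f a * g a :=
  Primrec.nat_mul.comp hf hg

theorem pr_div {f : A → ℕ} (hf : Primrec f) (n : ℕ) : Primrec fun a => f a / n :=
  Primrec.nat_div.comp hf (Primrec.const n)

theorem pr_mod_eq {f : A → ℕ} (hf : Primrec f) (n m : ℕ) : PrimrecPred fun a => f a % n = m :=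
  Primrec.eq.comp (Primrec.nat_mod.comp hf (Primrec.const n)) (Primrec.const m)

theorem pr_eq {f : A → ℕ} (hf : Primrec f) (m : ℕ) : PrimrecPred fun a => f a = m :=
  Primrec.eq.comp hf (Primrec.const m)

theorem pr_getD {f : A → List B} (hf : Primrec f) (n : ℕ) (d : B) :
    Primrec fun a => (f a).getD n d :=
  (Primrec.list_getD d).comp hf (Primrec.const n)

theorem pr_cons {f : A → B} {g : A → List B} (hf : Primrec f) (hg : Primrec g) :
    Primrec fun a => f a :: g a :=
  Primrec.list_cons.comp hf hg

theorem pr_up1 {f : A → ℕ} (hf : Primrec f) : Primrec fun a => (f a).unpair.1 :=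
  Primrec.fst.comp (Primrec.unpair.comp hf)

theorem pr_up2 {f : A → ℕ} (hf : Primrec f) : Primrec fun a => (f a).unpair.2 :=
  Primrec.snd.comp (Primrec.unpair.comp hf)

theorem pr_s {f : A → E} (hf : Primrec f) : Primrec fun a => (f a).1 := Primrec.fst.comp hf

theorem pr_p {f : A → E} (hf : Primrec f) : Primrec fun a => (f a).2.1 :=
  Primrec.fst.comp (Primrec.snd.comp hf)

theorem pr_q {f : A → E} (hf : Primrec f) : Primrec fun a => (f a).2.2 :=
  Primrec.snd.comp (Primrec.snd.comp hf)

theorem pr_mulE {f g : A → E} (hf : Primrec f) (hg : Primrec g) :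
    Primrec fun a => mulE (f a) (g a) :=
  Primrec.pair (pr_mul (pr_s hf) (pr_s hg))
    (Primrec.pair (pr_add (pr_p hf) (pr_p hg)) (pr_add (pr_q hf) (pr_q hg)))

theorem pr_divE {f g : A → E} (hf : Primrec f) (hg : Primrec g) :
    Primrec fun a => divE (f a) (g a) :=
  Primrec.pair (pr_mul (pr_s hf) (pr_s hg))
    (Primrec.pair (pr_add (pr_p hf) (pr_q hg)) (pr_add (pr_q hf) (pr_p hg)))

theorem pr_ltE {f g : A → E} (hf : Primrec f) (hg : Primrec g) :
    PrimrecPred fun a => ltE (f a) (g a) := by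
  unfold ltE
  refine PrimrecPred.or (.and (pr_mod_eq (pr_s hf) 3 1) (.and (pr_mod_eq (pr_s hg) 3 1) ?_))
    (.or (.and (pr_mod_eq (pr_s hf) 3 0) (pr_mod_eq (pr_s hg) 3 1))
      (.and (pr_mod_eq (pr_s hf) 3 2) (.or (.not (pr_mod_eq (pr_s hg) 3 2)) ?_)))
  · exact Primrec.nat_lt.comp (pr_add (pr_p hf) (pr_q hg)) (pr_add (pr_p hg) (pr_q hf))
  · exact Primrec.nat_lt.comp (pr_add (pr_p hg) (pr_q hf)) (pr_add (pr_p hf) (pr_q hg))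

theorem pr_stepT {f : A → List E} {t : A → ℕ} {g : A → List E} (hf : Primrec f) (ht : Primrec t)
    (hg : Primrec g) : Primrec fun a => stepT (f a) (t a) (g a) := by
  unfold stepT
  refine Primrec.ite (pr_mod_eq ht 2 0) (pr_cons ?_ hg)
    (Primrec.ite (pr_eq (pr_up1 (pr_div ht 2)) 0) (pr_cons ?_ hg) (pr_cons ?_ ?_))
  · exact (Primrec.list_getD _).comp hf (pr_div (pr_div ht 2) 2)
  · exact Primrec.pair (pr_up2 (pr_div ht 2)) (Primrec.const (0, 0))
  · exact Primrec.ite (pr_eq (pr_up2 (pr_div ht 2)) 0)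
      (pr_mulE (pr_getD hg 0 _) (pr_getD hg 1 _)) (pr_divE (pr_getD hg 0 _) (pr_getD hg 1 _))
  · exact Primrec.list_tail.comp (Primrec.list_tail.comp hg)

theorem pr_toList {f : A → ℕ} (hf : Primrec f) : Primrec fun a => toList (f a) :=
  Primrec.option_getD.comp (Primrec.decode.comp hf) (Primrec.const [])

theorem pr_termVal {t : A → ℕ} {f : A → List E} (ht : Primrec t) (hf : Primrec f) :
    Primrec fun a => termVal (t a) (f a) := by
  unfold termVal
  refine pr_getD ?_ 0 _
  refine Primrec.list_foldr (h := fun a p => stepT (f a) p.1 p.2)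
    (pr_toList (pr_up2 (pr_div ht 2))) (Primrec.const []) ?_
  exact pr_stepT (hf.comp Primrec.fst) (Primrec.fst.comp Primrec.snd)
    (Primrec.snd.comp Primrec.snd)

theorem pr_scale {k : A → ℕ} {f : A → E} (hk : Primrec k) (hf : Primrec f) :
    Primrec fun a => scale (k a) (f a) :=
  Primrec.pair (pr_s hf) (Primrec.pair (pr_mul hk (pr_p hf)) (pr_mul hk (pr_q hf)))

theorem pr_wt {f : A → List E} (hf : Primrec f) : Primrec fun a => wt (f a) := by
  unfold wt
  refine Primrec.list_foldr (h := fun _ p => p.1.2.1 + p.1.2.2 + p.2) hf (Primrec.const 0) ?_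
  have h1 : Primrec fun p : A × E × ℕ => p.2.1 := Primrec.fst.comp Primrec.snd
  exact pr_add (pr_add (pr_p h1) (pr_q h1)) (Primrec.snd.comp Primrec.snd)

theorem pr_fact {f : A → ℕ} (hf : Primrec f) : Primrec fun a => fact (f a) := by
  unfold fact
  refine Primrec.nat_rec' (h := fun _ p => (p.1 + 1) * p.2) hf (Primrec.const 1) ?_
  exact pr_mul (pr_add (Primrec.fst.comp Primrec.snd) (Primrec.const 1))
    (Primrec.snd.comp Primrec.snd)

theorem pr_bd {f g : A → ℕ} (hf : Primrec f) (hg : Primrec g) :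
    Primrec fun a => bd (f a) (g a) :=
  pr_pow (pr_add hf (Primrec.const 2)) (pr_pow (Primrec.const 3) (pr_sub hf hg))

theorem pr_ext {c : A → ℕ} {f : A → List E} (hc : Primrec c) (hf : Primrec f) :
    Primrec fun a => ext (c a) (f a) := by
  unfold ext
  have hb : Primrec fun a => bd (c a) ((f a).length + 1) :=
    pr_bd hc (pr_add (Primrec.list_length.comp hf) (Primrec.const 1))
  have hk : Primrec fun a => 2 * fact (bd (c a) ((f a).length + 1)) :=
    pr_mul (Primrec.const 2) (pr_fact hb)
  have hr : Primrec fun a => List.range (2 * fact (bd (c a) ((f a).length + 1)) *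
      bd (c a) ((f a).length + 1) * wt (f a) + 2) :=
    Primrec.list_range.comp (pr_add (pr_mul (pr_mul hk hb) (pr_wt hf)) (Primrec.const 2))
  have hm : Primrec fun a => (f a).map (scale (2 * fact (bd (c a) ((f a).length + 1)))) :=
    Primrec.list_map hf (pr_scale (hk.comp Primrec.fst) Primrec.snd)
  refine Primrec.list_flatMap (Primrec.const (List.range 3)) ?_
  refine Primrec.list_flatMap (hr.comp Primrec.fst) ?_
  refine Primrec.list_map (hr.comp (Primrec.fst.comp Primrec.fst)) ?_
  refine Primrec.list_append.comp
    (hm.comp (Primrec.fst.comp (Primrec.fst.comp Primrec.fst))) (pr_cons ?_ (Primrec.const []))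
  exact Primrec.pair (Primrec.snd.comp (Primrec.fst.comp Primrec.fst))
    (Primrec.pair (Primrec.snd.comp Primrec.fst) Primrec.snd)

theorem pr_envs {c n : A → ℕ} (hc : Primrec c) (hn : Primrec n) :
    Primrec fun a => envs (c a) (n a) := by
  unfold envs
  refine Primrec.nat_rec' (h := fun a p => p.2.flatMap (ext (c a))) hn
    (Primrec.const [List.nil]) ?_
  refine Primrec.list_flatMap (Primrec.snd.comp Primrec.snd) ?_
  exact pr_ext (hc.comp (Primrec.fst.comp Primrec.fst)) Primrec.snd

theorem pr_eqItem {c t₁ t₂ : A → ℕ} (hc : Primrec c) (h1 : Primrec t₁) (h2 : Primrec t₂) :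
    Primrec fun a => eqItem (c a) (t₁ a) (t₂ a) := by
  unfold eqItem
  have hn := pr_up1 (pr_div h1 2)
  have g1 : Primrec fun p : A × List E => termVal (t₁ p.1) p.2 :=
    pr_termVal (h1.comp Primrec.fst) Primrec.snd
  have g2 : Primrec fun p : A × List E => termVal (t₂ p.1) p.2 :=
    pr_termVal (h2.comp Primrec.fst) Primrec.snd
  refine Primrec.pair hn (pr_filter (R := fun a e => ¬ ltE (termVal (t₁ a) e) (termVal (t₂ a) e) ∧
    ¬ ltE (termVal (t₂ a) e) (termVal (t₁ a) e)) (pr_envs hc hn) ?_)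
  exact .and (.not (pr_ltE g1 g2)) (.not (pr_ltE g2 g1))

theorem pr_ltItem {c t₁ t₂ : A → ℕ} (hc : Primrec c) (h1 : Primrec t₁) (h2 : Primrec t₂) :
    Primrec fun a => ltItem (c a) (t₁ a) (t₂ a) := by
  unfold ltItem
  have hn := pr_up1 (pr_div h1 2)
  have g1 : Primrec fun p : A × List E => termVal (t₁ p.1) p.2 :=
    pr_termVal (h1.comp Primrec.fst) Primrec.snd
  have g2 : Primrec fun p : A × List E => termVal (t₂ p.1) p.2 :=
    pr_termVal (h2.comp Primrec.fst) Primrec.snd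
  exact Primrec.pair hn (pr_filter (R := fun a e => ltE (termVal (t₁ a) e) (termVal (t₂ a) e))
    (pr_envs hc hn) (pr_ltE g1 g2))

theorem pr_impItem {c : A → ℕ} {f g : A → Item} (hc : Primrec c) (hf : Primrec f)
    (hg : Primrec g) : Primrec fun a => impItem (c a) (f a) (g a) := by
  unfold impItem
  have hn : Primrec fun a => (f a).1 := Primrec.fst.comp hf
  refine Primrec.pair hn (pr_filter (R := fun a e => ¬ (∃ e' ∈ (f a).2, e' = e) ∨
    ∃ e' ∈ (g a).2, e' = e) (pr_envs hc hn) ?_)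
  exact .or (.not (pr_exists_eq (Primrec.snd.comp (hf.comp Primrec.fst)) Primrec.snd))
    (pr_exists_eq (Primrec.snd.comp (hg.comp Primrec.fst)) Primrec.snd)

theorem pr_allItem {c : A → ℕ} {f : A → Item} (hc : Primrec c) (hf : Primrec f) :
    Primrec fun a => allItem (c a) (f a) := by
  unfold allItem
  have hn : Primrec fun a => (f a).1 - 1 := pr_sub (Primrec.fst.comp hf) (Primrec.const 1)
  refine Primrec.pair hn (pr_filter (R := fun a e => ∀ e' ∈ ext (c a) e, ∃ u ∈ (f a).2, u = e')
    (pr_envs hc hn) ?_)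
  refine pr_forall (R := fun (p : A × List E) e' => ∃ u ∈ (f p.1).2, u = e')
    (pr_ext (hc.comp Primrec.fst) Primrec.snd) ?_
  exact pr_exists_eq (Primrec.snd.comp (hf.comp (Primrec.fst.comp Primrec.fst))) Primrec.snd

theorem pr_stepF {c t : A → ℕ} {l : A → List ℕ} {H : A → List (List Item)} (hc : Primrec c)
    (ht : Primrec t) (hl : Primrec l) (hH : Primrec H) :
    Primrec fun a => stepF (c a) (t a) (l a) (H a) := by
  unfold stepF
  have h0 := pr_getD hH 0 []
  have ht2 := pr_div ht 2
  have ht4 := pr_div ht2 2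
  refine Primrec.ite (pr_mod_eq ht 2 0) (pr_cons (pr_eqItem hc ht (pr_getD hl 0 0)) (pr_getD hH 1 _))
    (Primrec.ite (pr_mod_eq ht2 2 0)
      (pr_cons (pr_ltItem hc (pr_getD hl 1 0) (pr_getD hl 2 0)) (pr_getD hH 3 _))
      (Primrec.ite (pr_eq ht4 0)
        (pr_cons (pr_impItem hc (pr_getD h0 0 _) (pr_getD h0 1 _))
          (Primrec.list_tail.comp (Primrec.list_tail.comp h0)))
        (Primrec.ite (pr_eq ht4 1)
          (pr_cons (pr_allItem hc (pr_getD h0 0 _)) (Primrec.list_tail.comp h0))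
          (pr_cons (Primrec.pair (pr_sub ht4 (Primrec.const 2)) (Primrec.const [])) h0))))

theorem pr_hist {c : A → ℕ} {l : A → List ℕ} (hc : Primrec c) (hl : Primrec l) :
    Primrec fun a => hist (c a) (l a) := by
  unfold hist
  refine Primrec.list_rec (h := fun a p => stepF (c a) p.1 p.2.1 p.2.2 :: p.2.2) hl
    (Primrec.const [List.nil]) ?_
  have h2 : Primrec fun p : A × ℕ × List ℕ × List (List Item) => p.2.2 :=
    Primrec.snd.comp Primrec.snd
  exact pr_cons (pr_stepF (hc.comp Primrec.fst) (Primrec.fst.comp Primrec.snd)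
    (Primrec.fst.comp h2) (Primrec.snd.comp h2)) (Primrec.snd.comp h2)

end PrimrecSection

theorem primrec_decis : Primrec decis := by
  have h : Primrec fun c => stackOf c (toList c) :=
    pr_getD (pr_hist Primrec.id (pr_toList Primrec.id)) 0 []
  have h' : Primrec fun c => ((stackOf c (toList c)).getD 0 (0, [])).2 :=
    Primrec.snd.comp (pr_getD h 0 _)
  exact (pr_exists_eq h' (Primrec.const [])).decide

end Paper

namespace Paper

open FirstOrder Language

/-- **Proposition 3.3**: the theory of `(ℝ; 0, 1, -1, ×, ÷, <)`, with the convention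
`x ÷ 0 = 0`, admits elimination of quantifiers, and hence is decidable. -/
theorem divLang_qe_and_decidable :
    (∀ (α : Type) (φ : divLang.Formula α), ∃ ψ : divLang.Formula α,
      ψ.IsQF ∧ ∀ v : α → ℝ, φ.Realize v ↔ ψ.Realize v) ∧
    DecidableVia (divLang.completeTheory ℝ) := by
  refine ⟨fun α φ => ?_, decis, primrec_decis.to_comp, decis_spec⟩
  obtain ⟨ψ, h1, h2⟩ := qe_all φ
  exact ⟨ψ, h1, fun v => (h2 v).symm⟩

end Paper
end
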